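/- arXiv:2604.04752 — 6 statements merged into one kernel-verified Lean document; each statement's English description precedes it below -/
import Mathlib

section
/- For every real c > 0 and all integers k ≥ 1, b ≥ 1, there exists n₀ such that the following holds: for every directed graph G with n ≥ n₀ vertices, with positive integer edge lengths at most n^k, for every ε with 1/(log₂ n)^b ≤ ε < 1, and for every set P of p demand pairs of vertices, there exists a subgraph H of G with at most (n + p·√n)·n^c edges such that dist_H(s,t) ≤ (1+ε)·dist_G(s,t) for every (s,t) ∈ P. -/
open scoped Classical ENNReal

/-- `IsWalk E s t l`: `l` is the list of successive vertices (after `s`) of a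
directed walk from `s` to `t` in the graph with edge relation `E`. -/
def IsWalk {V : Type*} (E : V → V → Prop) : V → V → List V → Prop
  | s, t, [] => s = t
  | s, t, v :: rest => E s v ∧ IsWalk E v t rest

/-- Total length of the walk starting at `s` with successive vertices `l`. -/
def walkLen {V : Type*} (ℓ : V → V → ℕ) : V → List V → ℕ
  | _, [] => 0
  | s, v :: rest => ℓ s v + walkLen ℓ v rest

/-- Shortest-path distance from `s` to `t` (`∞` if `t` is unreachable from `s`). -/
noncomputable def gdist {V : Type*} (E : V → V → Prop) (ℓ : V → V → ℕ) (s t : V) : ℝ≥0∞ :=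
  ⨅ (l : List V) (_ : IsWalk E s t l), (walkLen ℓ s l : ℝ≥0∞)

/-- Set-to-set shortest-path distance. -/
noncomputable def gdistSet {V : Type*} (E : V → V → Prop) (ℓ : V → V → ℕ)
    (A B : Set V) : ℝ≥0∞ :=
  ⨅ (a ∈ A) (b ∈ B), gdist E ℓ a b

/-- A directed graph is acyclic (a DAG). -/
def IsDag {V : Type*} (E : V → V → Prop) : Prop := ∀ x : V, ¬ Relation.TransGen E x x


/-! ### Basic facts on walks -/

lemma isWalk_append {V : Type*} {E : V → V → Prop} {s t : V} {l₁ l₂ : List V} :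
    IsWalk E s t (l₁ ++ l₂) ↔ ∃ u, IsWalk E s u l₁ ∧ IsWalk E u t l₂ := by
  induction l₁ generalizing s with
  | nil => simp [IsWalk]
  | cons a l ih =>
    simp only [List.cons_append, IsWalk, ih]
    constructor
    · rintro ⟨h, u, h1, h2⟩
      exact ⟨u, ⟨h, h1⟩, h2⟩
    · rintro ⟨u, ⟨h, h1⟩, h2⟩
      exact ⟨h, u, h1, h2⟩

lemma walkLen_append {V : Type*} {E : V → V → Prop} {ℓ : V → V → ℕ} {s u : V}
    {l₁ l₂ : List V} (h : IsWalk E s u l₁) :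
    walkLen ℓ s (l₁ ++ l₂) = walkLen ℓ s l₁ + walkLen ℓ u l₂ := by
  induction l₁ generalizing s with
  | nil => simp [IsWalk] at h; subst h; simp [walkLen]
  | cons a l ih =>
    simp only [List.cons_append, walkLen, ih h.2]
    ring

lemma isWalk_mono {V : Type*} {E F : V → V → Prop} (hEF : ∀ u v, E u v → F u v) {s t : V}
    {l : List V} (h : IsWalk E s t l) : IsWalk F s t l := by
  induction l generalizing s with
  | nil => exact h
  | cons a l ih => exact ⟨hEF _ _ h.1, ih h.2⟩

lemma isWalk_end_unique {V : Type*} {E F : V → V → Prop} {s t t' : V} {l : List V}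
    (h : IsWalk E s t l) (h' : IsWalk F s t' l) : t = t' := by
  induction l generalizing s with
  | nil => simp [IsWalk] at h h'; rw [← h, ← h']
  | cons a l ih => exact ih h.2 h'.2

/-- `DLe E ℓ s t ρ`: the distance from `s` to `t` is at most `ρ`. -/
def DLe {V : Type*} (E : V → V → Prop) (ℓ : V → V → ℕ) (s t : V) (ρ : ℕ) : Prop :=
  ∃ l, IsWalk E s t l ∧ walkLen ℓ s l ≤ ρ

lemma DLe.trans {V : Type*} {E : V → V → Prop} {ℓ : V → V → ℕ} {s t u : V} {a b : ℕ}
    (h : DLe E ℓ s t a) (h' : DLe E ℓ t u b) : DLe E ℓ s u (a + b) := by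
  obtain ⟨l, h1, h2⟩ := h
  obtain ⟨m, h3, h4⟩ := h'
  refine ⟨l ++ m, isWalk_append.2 ⟨_, h1, h3⟩, ?_⟩
  rw [walkLen_append h1]
  omega

lemma DLe.mono {V : Type*} {E F : V → V → Prop} {ℓ : V → V → ℕ} {s t : V} {a b : ℕ}
    (h : DLe E ℓ s t a) (hEF : ∀ u v, E u v → F u v) (hab : a ≤ b) : DLe F ℓ s t b := by
  obtain ⟨l, h1, h2⟩ := h
  exact ⟨l, isWalk_mono hEF h1, by omega⟩

lemma DLe.refl {V : Type*} {E : V → V → Prop} {ℓ : V → V → ℕ} (s : V) (a : ℕ) :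
    DLe E ℓ s s a := ⟨[], rfl, by simp [walkLen]⟩

lemma DLe.edge {V : Type*} {E : V → V → Prop} {ℓ : V → V → ℕ} {s t : V} (h : E s t) :
    DLe E ℓ s t (ℓ s t) := ⟨[t], ⟨h, rfl⟩, by simp [walkLen]⟩

/-- Natural-number valued distance (junk if unreachable). -/
noncomputable def ndist {V : Type*} (E : V → V → Prop) (ℓ : V → V → ℕ) (s t : V) : ℕ :=
  sInf {n | DLe E ℓ s t n}

lemma ndist_spec {V : Type*} {E : V → V → Prop} {ℓ : V → V → ℕ} {s t : V} {a : ℕ}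
    (h : DLe E ℓ s t a) : DLe E ℓ s t (ndist E ℓ s t) :=
  Nat.sInf_mem (s := {n | DLe E ℓ s t n}) ⟨a, h⟩

lemma ndist_le {V : Type*} {E : V → V → Prop} {ℓ : V → V → ℕ} {s t : V} {a : ℕ}
    (h : DLe E ℓ s t a) : ndist E ℓ s t ≤ a := Nat.sInf_le h

/-! ### Exact preservers in DAGs -/

lemma dag_pairwise {N : ℕ} {F : Fin N → Fin N → Prop} (hF : ∀ i j, F i j → i < j)
    {s t : Fin N} {l : List (Fin N)} (h : IsWalk F s t l) :
    (s :: l).Pairwise (· < ·) := by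
  induction l generalizing s with
  | nil => simp
  | cons a l ih =>
    have := ih h.2
    have hs := hF _ _ h.1
    rw [List.pairwise_cons]
    refine ⟨?_, this⟩
    intro b hb
    rcases List.mem_cons.1 hb with rfl | hb
    · exact hs
    · exact hs.trans ((List.pairwise_cons.1 this).1 b hb)

/-- A walk which is not a walk of the graph without `e` uses `e`. -/
lemma uses_edge {V : Type*} {F : V → V → Prop} {a v : V} {s t : V} {l : List V}
    (h : IsWalk F s t l)
    (hn : ¬ IsWalk (fun x y => F x y ∧ ¬ (x = a ∧ y = v)) s t l) :
    ∃ l₁ l₂, l = l₁ ++ v :: l₂ ∧ IsWalk F s a l₁ ∧ IsWalk F v t l₂ ∧ F a v := by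
  induction l generalizing s with
  | nil => exact absurd h hn
  | cons x l ih =>
    by_cases hx : s = a ∧ x = v
    · obtain ⟨rfl, rfl⟩ := hx
      exact ⟨[], l, rfl, rfl, h.2, h.1⟩
    · have : ¬ IsWalk (fun x y => F x y ∧ ¬ (x = a ∧ y = v)) x t l := by
        intro h'
        exact hn ⟨⟨h.1, hx⟩, h'⟩
      obtain ⟨l₁, l₂, h1, h2, h3, h4⟩ := ih h.2 this
      exact ⟨x :: l₁, l₂, by rw [h1]; rfl, ⟨h.1, h2⟩, h3, h4⟩

lemma nodup_split_unique {V : Type*} {v : V} {l₁ l₂ m₁ m₂ : List V}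
    (hnd : (l₁ ++ v :: l₂).Nodup) (h : l₁ ++ v :: l₂ = m₁ ++ v :: m₂) : l₁ = m₁ := by
  induction l₁ generalizing m₁ with
  | nil =>
    cases m₁ with
    | nil => rfl
    | cons x m₁ =>
      simp only [List.nil_append, List.cons_append, List.cons.injEq] at h
      simp only [List.nil_append, List.nodup_cons] at hnd
      exact absurd (by rw [h.2]; simp) hnd.1
  | cons y l₁ ih =>
    cases m₁ with
    | nil =>
      simp only [List.nil_append, List.cons_append, List.cons.injEq] at h
      simp only [List.cons_append, List.nodup_cons] at hnd
      exact absurd (by rw [h.1]; simp) hnd.1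
    | cons x m₁ =>
      simp only [List.cons_append, List.cons.injEq] at h
      simp only [List.cons_append, List.nodup_cons] at hnd
      rw [h.1, ih hnd.2 h.2]

/-- `e = (a, v)` is critical for `(s, t)`. -/
def Crit {V : Type*} (F : V → V → Prop) (ℓ : V → V → ℕ) (s t a v : V) (B : ℕ) : Prop :=
  DLe F ℓ s t B ∧ ¬ DLe (fun x y => F x y ∧ ¬ (x = a ∧ y = v)) ℓ s t B

lemma crit_enter {N : ℕ} {F : Fin N → Fin N → Prop} (hF : ∀ i j, F i j → i < j)
    {ℓ : Fin N → Fin N → ℕ} {s t a v a' : Fin N} {B : ℕ} (h : Crit F ℓ s t a v B)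
    {x y : ℕ} (h1 : DLe F ℓ s a' x) (h2 : F a' v) (h3 : DLe F ℓ v t y)
    (hxy : x + ℓ a' v + y ≤ B) : a = a' := by
  obtain ⟨l, hl, hl'⟩ := h1
  obtain ⟨m, hm, hm'⟩ := h3
  have hw : IsWalk F s t (l ++ v :: m) := isWalk_append.2 ⟨_, hl, h2, hm⟩
  have hlen : walkLen ℓ s (l ++ v :: m) ≤ B := by
    rw [walkLen_append hl, walkLen]; omega
  have hn : ¬ IsWalk (fun x y => F x y ∧ ¬ (x = a ∧ y = v)) s t (l ++ v :: m) := by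
    intro h'
    exact h.2 ⟨_, h', hlen⟩
  obtain ⟨l₁, l₂, e, w1, w2, w3⟩ := uses_edge hw hn
  have hnd : (l ++ v :: m).Nodup := by
    have := dag_pairwise hF hw
    exact ((List.pairwise_cons.1 this).2).imp (fun h => ne_of_lt h)
  have := nodup_split_unique hnd e
  subst this
  exact isWalk_end_unique w1 hl

/-- walk through the critical edge and another vertex `u` -/
lemma crit_split {N : ℕ} {F : Fin N → Fin N → Prop} (hF : ∀ i j, F i j → i < j)
    {ℓ : Fin N → Fin N → ℕ} {s t a v b u : Fin N} {B B' : ℕ} (h : Crit F ℓ s t a v B)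
    (h' : Crit F ℓ s t b u B') (hBB : B ≤ B') (huv : u < v) :
    ∃ x y z, DLe F ℓ s u x ∧ DLe F ℓ u a y ∧ F a v ∧ DLe F ℓ v t z ∧
      x + y + ℓ a v + z ≤ B := by
  obtain ⟨l, hl, hlen⟩ := h.1
  have hn : ¬ IsWalk (fun x y => F x y ∧ ¬ (x = a ∧ y = v)) s t l := fun hh => h.2 ⟨_, hh, hlen⟩
  have hn' : ¬ IsWalk (fun x y => F x y ∧ ¬ (x = b ∧ y = u)) s t l :=
    fun hh => h'.2 ⟨_, hh, hlen.trans hBB⟩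
  obtain ⟨l₁, l₂, e, w1, w2, w3⟩ := uses_edge hl hn
  obtain ⟨m₁, m₂, e', w1', w2', w3'⟩ := uses_edge hl hn'
  have hp := dag_pairwise hF hl
  have hu : u ∈ l₁ := by
    have : u ∈ l := by rw [e']; simp
    rw [e] at this
    rcases List.mem_append.1 this with h | h
    · exact h
    · exfalso
      rw [e, List.pairwise_cons, List.pairwise_append] at hp
      rcases List.mem_cons.1 h with h | h
      · exact absurd huv (by rw [h]; exact lt_irrefl _)
      · exact absurd huv (not_lt.2 (le_of_lt ((List.pairwise_cons.1 hp.2.2.1).1 u h)))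
  obtain ⟨p, q, rfl⟩ := List.append_of_mem hu
  have hp1 : IsWalk F s a ((p ++ [u]) ++ q) := by simpa using w1
  obtain ⟨u', c1, c2⟩ := isWalk_append.1 hp1
  have : u' = u := by
    obtain ⟨_, _, c3⟩ := isWalk_append.1 c1
    exact c3.2.symm
  subst this
  refine ⟨_, _, _, ⟨_, c1, le_rfl⟩, ⟨_, c2, le_rfl⟩, w3, ⟨_, w2, le_rfl⟩, ?_⟩
  have e2 : l = (p ++ [u']) ++ (q ++ v :: l₂) := by rw [e]; simp
  rw [e2, walkLen_append c1, walkLen_append c2, walkLen] at hlen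
  omega

lemma crit_pair {N : ℕ} {F : Fin N → Fin N → Prop} (hF : ∀ i j, F i j → i < j)
    {ℓ : Fin N → Fin N → ℕ} {s t s' t' a v a' b b' u : Fin N} {B B' C C' : ℕ}
    (h1 : Crit F ℓ s t a v B) (h2 : Crit F ℓ s' t' a' v B')
    (h3 : Crit F ℓ s t b u C) (h4 : Crit F ℓ s' t' b' u C')
    (hB : B ≤ C) (hB' : B' ≤ C') (huv : u < v) : a = a' := by
  obtain ⟨x, y, z, p1, p2, p3, p4, p5⟩ := crit_split hF h1 h3 hB huv
  obtain ⟨x', y', z', q1, q2, q3, q4, q5⟩ := crit_split hF h2 h4 hB' huv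
  rcases le_total (y' + ℓ a' v) (y + ℓ a v) with h | h
  · exact crit_enter hF h1 (p1.trans q2) q3 p4 (by omega)
  · exact (crit_enter hF h2 (q1.trans p2) p3 q4 (by omega)).symm

theorem dag_preserver {N : ℕ} (F : Fin N → Fin N → Prop) (hF : ∀ i j, F i j → i < j)
    (ℓ : Fin N → Fin N → ℕ) (Q : Finset (Fin N × Fin N)) :
    ∃ H : Finset (Fin N × Fin N), (∀ e ∈ H, F e.1 e.2) ∧
      ((H.card : ℝ) ≤ N + Q.card * Real.sqrt N) ∧
      ∀ q ∈ Q, ∀ B, DLe F ℓ q.1 q.2 B → DLe (fun i j => (i, j) ∈ H) ℓ q.1 q.2 B := by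
  classical
  let good : Finset (Fin N × Fin N) → Prop := fun H => (∀ e ∈ H, F e.1 e.2) ∧
    ∀ q ∈ Q, ∀ B, DLe F ℓ q.1 q.2 B → DLe (fun i j => (i, j) ∈ H) ℓ q.1 q.2 B
  have hex : ((Finset.univ : Finset (Finset (Fin N × Fin N))).filter good).Nonempty := by
    refine ⟨Finset.univ.filter (fun e => F e.1 e.2), ?_⟩
    rw [Finset.mem_filter]
    refine ⟨Finset.mem_univ _, by simp, ?_⟩
    intro q _ B h
    refine h.mono ?_ le_rfl
    intro u v huv
    simpa using huv
  obtain ⟨H, hH, hmin⟩ := Finset.exists_min_image _ Finset.card hex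
  rw [Finset.mem_filter] at hH
  obtain ⟨-, hH1, hH2⟩ := hH
  refine ⟨H, hH1, ?_, hH2⟩
  have hH1' : ∀ i j, (i, j) ∈ H → i < j := fun i j h => hF _ _ (hH1 _ h)
  -- critical pairs
  have hcrit : ∀ e ∈ H, ∃ q ∈ Q,
      Crit (fun i j => (i, j) ∈ H) ℓ q.1 q.2 e.1 e.2
        (ndist (fun i j => (i, j) ∈ H) ℓ q.1 q.2) := by
    intro e he
    by_contra hcon
    push Not at hcon
    have hg : good (H.erase e) := by
      refine ⟨fun x hx => hH1 _ (Finset.mem_of_mem_erase hx), ?_⟩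
      intro q hq B hB
      have h1 := hH2 q hq B hB
      have h2 := ndist_spec h1
      have h3 := ndist_le h1
      have h4 := hcon q hq
      unfold Crit at h4
      have h5 := not_and_not_right.1 h4 h2
      refine h5.mono ?_ h3
      rintro x y ⟨hx, hy⟩
      refine Finset.mem_erase.2 ⟨?_, hx⟩
      rintro rfl
      exact hy ⟨rfl, rfl⟩
    have := hmin (H.erase e) (Finset.mem_filter.2 ⟨Finset.mem_univ _, hg⟩)
    have h2 := Finset.card_erase_lt_of_mem he
    omega
  choose! q hqQ hq using hcrit
  set T := (H ×ˢ H).filter (fun z => z.1.2 = z.2.2) with hT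
  have hinj : ((T.filter (fun z => z.1 ≠ z.2)).card) ≤ (Q ×ˢ Q).card := by
    apply Finset.card_le_card_of_injOn (fun z => (q z.1, q z.2))
    · intro z hz
      simp only [hT, Finset.coe_filter, Finset.mem_filter, Finset.mem_product, Set.mem_ofPred_eq] at hz
      simp only [Finset.coe_product, Set.mem_prod, Finset.mem_coe]
      exact ⟨hqQ _ hz.1.1.1, hqQ _ hz.1.1.2⟩
    · rintro ⟨⟨a, v⟩, ⟨a', v'⟩⟩ hz ⟨⟨b, u⟩, ⟨b', u'⟩⟩ hw heq
      simp only [hT, Finset.coe_filter, Finset.mem_filter, Finset.mem_product, Set.mem_ofPred_eq] at hz hw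
      obtain ⟨⟨⟨z1, z2⟩, rfl⟩, z3⟩ := hz
      obtain ⟨⟨⟨w1, w2⟩, rfl⟩, w3⟩ := hw
      simp only [Prod.mk.injEq] at heq
      obtain ⟨e1, e2⟩ := heq
      have c1 := hq _ z1
      have c2 := hq _ z2
      have c3 := hq _ w1
      have c4 := hq _ w2
      rw [← e1] at c3
      rw [← e2] at c4
      rcases lt_trichotomy u v with h | h | h
      · exfalso
        apply z3
        rw [show a = a' from crit_pair hH1' c1 c2 c3 c4 le_rfl le_rfl h]
      · subst h
        have hz : ∀ x y, (x, u) ∈ H → ∀ s t B, Crit (fun i j => (i, j) ∈ H) ℓ s t x u B →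
            Crit (fun i j => (i, j) ∈ H) ℓ s t y u B → x = y := by
          intro x y _ s t B d1 d2
          obtain ⟨l, hl, hlen⟩ := d2.1
          obtain ⟨l₁, l₂, e, w1, w2, w3⟩ := uses_edge hl (fun hh => d2.2 ⟨_, hh, hlen⟩)
          refine crit_enter hH1' d1 ⟨_, w1, le_rfl⟩ w3 ⟨_, w2, le_rfl⟩ ?_
          rw [e, walkLen_append w1, walkLen] at hlen
          omega
        rw [hz a b z1 _ _ _ c1 c3, hz a' b' z2 _ _ _ c2 c4]
      · exfalso
        apply w3
        rw [show b = b' from crit_pair hH1' c3 c4 c1 c2 le_rfl le_rfl h]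
  -- Cauchy-Schwarz
  have hTcard : T.card ≤ H.card + Q.card ^ 2 := by
    have h1 : T.card = (T.filter (fun z => z.1 = z.2)).card + (T.filter (fun z => z.1 ≠ z.2)).card := by
      rw [← Finset.card_filter_add_card_filter_not (s := T) (fun z => z.1 = z.2)]
    have h2 : (T.filter (fun z => z.1 = z.2)).card ≤ H.card := by
      apply Finset.card_le_card_of_injOn (fun z => z.1)
      · intro z hz
        simp only [hT, Finset.coe_filter, Finset.mem_filter, Finset.mem_product, Set.mem_ofPred_eq] at hz
        exact hz.1.1.1
      · rintro ⟨z1, z2⟩ hz ⟨w1, w2⟩ hw heq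
        simp only [hT, Finset.coe_filter, Finset.mem_filter, Finset.mem_product, Set.mem_ofPred_eq] at hz hw
        simp only at heq
        rw [← hz.2, ← hw.2, heq]
    rw [Finset.card_product] at hinj
    nlinarith
  have hsum : H.card = ∑ v : Fin N, (H.filter (fun e => e.2 = v)).card :=
    Finset.card_eq_sum_card_fiberwise (fun _ _ => Finset.mem_coe.2 (Finset.mem_univ _))
  have hsum2 : T.card = ∑ v : Fin N, (H.filter (fun e => e.2 = v)).card ^ 2 := by
    rw [Finset.card_eq_sum_card_fiberwise (f := fun z => z.1.2) (t := Finset.univ)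
      (fun _ _ => Finset.mem_coe.2 (Finset.mem_univ _))]
    refine Finset.sum_congr rfl ?_
    intro v _
    rw [sq, ← Finset.card_product]
    congr 1
    ext z
    simp only [hT, Finset.mem_filter, Finset.mem_product]
    constructor
    · rintro ⟨⟨⟨h1, h2⟩, h3⟩, h4⟩
      exact ⟨⟨h1, h4⟩, h2, by rw [← h3, h4]⟩
    · rintro ⟨⟨h1, h2⟩, h3, h4⟩
      exact ⟨⟨⟨h1, h3⟩, by rw [h2, h4]⟩, h2⟩
  have hcs : H.card ^ 2 ≤ N * T.card := by
    rw [hsum, hsum2]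
    have := sq_sum_le_card_mul_sum_sq (s := (Finset.univ : Finset (Fin N)))
      (f := fun v => (H.filter (fun e => e.2 = v)).card)
    simpa using this
  have hfin : (H.card : ℝ) ^ 2 ≤ N * (H.card + Q.card ^ 2) := by
    have : H.card ^ 2 ≤ N * (H.card + Q.card ^ 2) := hcs.trans (Nat.mul_le_mul_left _ hTcard)
    exact_mod_cast this
  by_contra hlt
  push Not at hlt
  have hs := Real.sq_sqrt (Nat.cast_nonneg (α := ℝ) N)
  have hs0 := Real.sqrt_nonneg (N : ℝ)
  have hN0 : (0 : ℝ) ≤ N := Nat.cast_nonneg N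
  have hQ0 : (0 : ℝ) ≤ Q.card := Nat.cast_nonneg _
  set x : ℝ := (H.card : ℝ) with hx
  set y : ℝ := (Q.card : ℝ) * Real.sqrt N with hyd
  have hy : 0 ≤ y := by positivity
  have hy2 : y ^ 2 = N * (Q.card : ℝ) ^ 2 := by
    rw [hyd, mul_pow, hs]; ring
  nlinarith [mul_pos (show 0 < x - N - y by linarith) (show 0 < x by nlinarith), mul_nonneg hy hN0]

/-! ### Ball growing and low-diameter ordered partitions -/

lemma grow_pow (vol cut : ℕ → ℕ) (q : ℕ) (d : ℕ)
    (hstep : ∀ ρ, vol ρ + cut ρ ≤ vol (ρ + 1))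
    (hbig : ∀ ρ ≤ d, vol ρ < q * cut ρ) (h1 : 1 ≤ vol 1) :
    ∀ T, q * T ≤ d → 2 ^ T ≤ vol (1 + q * T) := by
  have hmono : Monotone vol := monotone_nat_of_le_succ (fun ρ => by have := hstep ρ; omega)
  intro T
  induction T with
  | zero => intro _; simpa using h1
  | succ T ih =>
    intro hT
    have hT' : q * T + q ≤ d := by rw [← Nat.mul_succ]; exact hT
    have h2 := ih (by omega)
    set a := 1 + q * T with ha
    -- each of the `q` steps gains at least `vol a / q`
    have h3 : ∀ i ≤ q, q * vol a + i * vol a ≤ q * vol (a + i) := by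
      intro i
      induction i with
      | zero => intro _; simp
      | succ i ihi =>
        intro hi
        have e1 := ihi (by omega)
        have e2 := hbig (a + i) (by omega)
        have e3 := hstep (a + i)
        have e4 : vol a ≤ vol (a + i) := hmono (by omega)
        have e5 : q * (vol (a + i) + cut (a + i)) ≤ q * vol (a + i + 1) :=
          Nat.mul_le_mul_left _ e3
        rw [← add_assoc]
        nlinarith
    have hq : 0 < q := by
      rcases Nat.eq_zero_or_pos q with h | h
      · have := hbig 0 (by omega)
        rw [h] at this; omega
      · exact h
    have h4 := h3 q le_rfl
    have h5 : vol a + vol a ≤ vol (a + q) := by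
      have : q * (vol a + vol a) ≤ q * vol (a + q) := by linarith
      exact Nat.le_of_mul_le_mul_left this hq
    have h6 : 1 + q * (T + 1) = a + q := by rw [ha]; ring
    rw [h6, pow_succ]
    omega

lemma grow {V : Type*} (A : Finset V) (g : V → ℕ) (μ ℓ : V → V → ℕ) (d T : ℕ) (hT1 : 1 ≤ T)
    (h : ∀ u ∈ A, ∀ w ∈ A, μ u w ≠ 0 → g w ≤ g u + ℓ u w)
    (hT : ∑ u ∈ A, ∑ w ∈ A, μ u w * ℓ u w < 2 ^ T) :
    ∃ ρ ≤ d, (d + 1) * ∑ u ∈ A.filter (fun u => g u ≤ ρ), ∑ w ∈ A.filter (fun w => ¬ g w ≤ ρ), μ u w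
      ≤ 2 * T * ∑ u ∈ A.filter (fun u => g u ≤ ρ), ∑ w ∈ A, μ u w * ℓ u w := by
  set cut : ℕ → ℕ := fun ρ =>
    ∑ u ∈ A.filter (fun u => g u ≤ ρ), ∑ w ∈ A.filter (fun w => ¬ g w ≤ ρ), μ u w with hcut
  set full : ℕ → ℕ := fun ρ => ∑ u ∈ A.filter (fun u => g u ≤ ρ), ∑ w ∈ A, μ u w * ℓ u w with hfull
  set vol : ℕ → ℕ := fun ρ => ∑ u ∈ A, ∑ w ∈ A, μ u w * min (ℓ u w) (ρ - g u) with hvol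
  have hcut' : ∀ ρ, cut ρ = ∑ u ∈ A, ∑ w ∈ A, if g u ≤ ρ ∧ ¬ g w ≤ ρ then μ u w else 0 := by
    intro ρ
    simp only [hcut, Finset.sum_filter]
    refine Finset.sum_congr rfl fun u _ => ?_
    by_cases hu : g u ≤ ρ <;> simp [hu]
  have hvf : ∀ ρ, vol ρ ≤ full ρ := by
    intro ρ
    simp only [hvol, hfull, Finset.sum_filter]
    refine Finset.sum_le_sum fun u _ => ?_
    by_cases hu : g u ≤ ρ
    · simp only [hu, if_true]
      exact Finset.sum_le_sum fun w _ => Nat.mul_le_mul_left _ (min_le_left _ _)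
    · simp only [hu, if_false]
      have : ρ - g u = 0 := by omega
      simp [this]
  have hcf : ∀ ρ, cut ρ ≤ full ρ := by
    intro ρ
    rw [hcut']
    simp only [hfull, Finset.sum_filter]
    refine Finset.sum_le_sum fun u hu' => ?_
    by_cases hu : g u ≤ ρ
    · simp only [hu, if_true, true_and]
      refine Finset.sum_le_sum fun w hw' => ?_
      by_cases hw : g w ≤ ρ
      · simp [hw]
      · simp only [hw, not_false_iff, if_true]
        by_cases hm : μ u w = 0
        · simp [hm]
        · have := h u hu' w hw' hm
          exact Nat.le_mul_of_pos_right _ (by omega)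
    · simp [hu]
  have hstep : ∀ ρ, vol ρ + cut ρ ≤ vol (ρ + 1) := by
    intro ρ
    rw [hcut']
    simp only [hvol, ← Finset.sum_add_distrib]
    refine Finset.sum_le_sum fun u hu' => Finset.sum_le_sum fun w hw' => ?_
    split_ifs with hc
    · by_cases hm : μ u w = 0
      · simp [hm]
      · have := h u hu' w hw' hm
        have e : min (ℓ u w) (ρ + 1 - g u) = min (ℓ u w) (ρ - g u) + 1 := by omega
        rw [e]; exact le_of_eq (by ring)
    · rw [add_zero]
      exact Nat.mul_le_mul_left _ (by omega)
  have hft : ∀ ρ, full ρ ≤ ∑ u ∈ A, ∑ w ∈ A, μ u w * ℓ u w := fun ρ =>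
    Finset.sum_le_sum_of_subset (Finset.filter_subset _ _)
  by_cases h0 : cut 0 = 0
  · exact ⟨0, Nat.zero_le _, by change (d + 1) * cut 0 ≤ _; rw [h0]; simp⟩
  by_cases hdT : d < T
  · refine ⟨0, Nat.zero_le _, ?_⟩
    change (d + 1) * cut 0 ≤ 2 * T * full 0
    exact Nat.mul_le_mul (by omega) (hcf 0)
  have hv1 : 1 ≤ vol 1 := by have := hstep 0; simp only [zero_add] at this; omega
  set q := d / T with hq
  have hq1 : q * T ≤ d := Nat.div_mul_le_self _ _
  have hq2 : d < q * T + T := by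
    have := Nat.lt_div_mul_add (a := d) (b := T) (by omega); simpa [hq] using this
  have hq3 : 1 ≤ q := (Nat.one_le_div_iff (by omega)).2 (by omega)
  have : ∃ ρ ≤ d, q * cut ρ ≤ vol ρ := by
    by_contra hcon
    push Not at hcon
    have h1 := grow_pow vol cut q d hstep hcon hv1 T hq1
    have h2 := (hvf (1 + q * T)).trans (hft _)
    omega
  obtain ⟨ρ, hρ, hle⟩ := this
  refine ⟨ρ, hρ, ?_⟩
  change (d + 1) * cut ρ ≤ 2 * T * full ρ
  have e1 : q * cut ρ ≤ full ρ := hle.trans (hvf ρ)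
  have e2 : d + 1 ≤ 2 * T * q := by nlinarith
  calc (d + 1) * cut ρ ≤ 2 * T * q * cut ρ := Nat.mul_le_mul_right _ e2
    _ = 2 * T * (q * cut ρ) := by ring
    _ ≤ _ := Nat.mul_le_mul_left _ e1

/-- Restriction of a relation to a vertex set. -/
def rel {V : Type*} (E : V → V → Prop) (A : Finset V) (u v : V) : Prop := u ∈ A ∧ v ∈ A ∧ E u v

lemma rel_mono {V : Type*} {E : V → V → Prop} {A B : Finset V} (h : A ⊆ B) :
    ∀ u v, rel E A u v → rel E B u v := fun _ _ h' => ⟨h h'.1, h h'.2.1, h'.2.2⟩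

/-- weight of back edges -/
noncomputable def backW {V : Type*} (μ : V → V → ℕ) (A : Finset V) (f : V → ℕ) : ℕ :=
  ∑ u ∈ A, ∑ w ∈ A, if f w < f u then μ u w else 0

lemma merge_order {V : Type*} (μ : V → V → ℕ) (A A₁ A₂ : Finset V) (hA : A = A₁ ∪ A₂)
    (hd : Disjoint A₁ A₂) (f₁ f₂ : V → ℕ) :
    ∃ f : V → ℕ, (∀ u ∈ A, ∀ w ∈ A, f u = f w →
        (u ∈ A₁ ∧ w ∈ A₁ ∧ f₁ u = f₁ w) ∨ (u ∈ A₂ ∧ w ∈ A₂ ∧ f₂ u = f₂ w)) ∧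
      backW μ A f = backW μ A₁ f₁ + backW μ A₂ f₂ + ∑ u ∈ A₂, ∑ w ∈ A₁, μ u w := by
  set N := A₁.sup f₁ + 1 with hN
  have hlt : ∀ u ∈ A₁, f₁ u < N := fun u hu => Nat.lt_succ_of_le (Finset.le_sup hu)
  set f : V → ℕ := fun u => if u ∈ A₁ then f₁ u else f₂ u + N with hf
  have hf1 : ∀ u ∈ A₁, f u = f₁ u := fun u hu => by simp [hf, hu]
  have hf2 : ∀ u ∈ A₂, f u = f₂ u + N := fun u hu => by
    have : u ∉ A₁ := fun h => (Finset.disjoint_left.1 hd h hu)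
    simp [hf, this]
  refine ⟨f, ?_, ?_⟩
  · intro u hu w hw huw
    rw [hA, Finset.mem_union] at hu hw
    rcases hu with hu | hu <;> rcases hw with hw | hw
    · rw [hf1 u hu, hf1 w hw] at huw; exact Or.inl ⟨hu, hw, huw⟩
    · rw [hf1 u hu, hf2 w hw] at huw; have := hlt u hu; omega
    · rw [hf2 u hu, hf1 w hw] at huw; have := hlt w hw; omega
    · rw [hf2 u hu, hf2 w hw] at huw; exact Or.inr ⟨hu, hw, by omega⟩
  · unfold backW
    rw [hA, Finset.sum_union hd]
    simp only [Finset.sum_union hd, Finset.sum_add_distrib]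
    have e1 : ∑ u ∈ A₁, ∑ w ∈ A₁, (if f w < f u then μ u w else 0) =
        ∑ u ∈ A₁, ∑ w ∈ A₁, (if f₁ w < f₁ u then μ u w else 0) :=
      Finset.sum_congr rfl fun u hu => Finset.sum_congr rfl fun w hw => by
        rw [hf1 u hu, hf1 w hw]
    have e2 : ∑ u ∈ A₁, ∑ w ∈ A₂, (if f w < f u then μ u w else 0) = 0 :=
      Finset.sum_eq_zero fun u hu => Finset.sum_eq_zero fun w hw => by
        rw [hf1 u hu, hf2 w hw, if_neg]; have := hlt u hu; omega
    have e3 : ∑ u ∈ A₂, ∑ w ∈ A₁, (if f w < f u then μ u w else 0) =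
        ∑ u ∈ A₂, ∑ w ∈ A₁, μ u w :=
      Finset.sum_congr rfl fun u hu => Finset.sum_congr rfl fun w hw => by
        rw [hf2 u hu, hf1 w hw, if_pos]; have := hlt w hw; omega
    have e4 : ∑ u ∈ A₂, ∑ w ∈ A₂, (if f w < f u then μ u w else 0) =
        ∑ u ∈ A₂, ∑ w ∈ A₂, (if f₂ w < f₂ u then μ u w else 0) :=
      Finset.sum_congr rfl fun u hu => Finset.sum_congr rfl fun w hw => by
        rw [hf2 u hu, hf2 w hw]; simp
    rw [e1, e2, e3, e4]
    ring

/-- Volume of a vertex. -/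
noncomputable def vvol {V : Type*} [Fintype V] (μ ℓ : V → V → ℕ) (u : V) : ℕ :=
  ∑ w, (μ u w * ℓ u w + μ w u * ℓ w u)

lemma log_half {a b : ℕ} (ha : 0 < a) (h : 2 * a ≤ b) : Nat.log 2 a + 1 ≤ Nat.log 2 b := by
  rw [← Nat.log_mul_base (by norm_num) (by omega)]
  exact Nat.log_mono_right (by omega)

/-- truncated distances from a source are 1-Lipschitz -/
lemma exists_trunc {V : Type*} (R : V → ℕ → Prop) (hR : ∀ u a b, R u a → a ≤ b → R u b) (d : ℕ) :
    ∃ g : V → ℕ, (∀ u ρ, ρ ≤ d → (g u ≤ ρ ↔ R u ρ)) ∧ (∀ u, g u ≤ d + 1) := by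
  refine ⟨fun u => if h : ∃ a, R u a then min (Nat.find h) (d + 1) else d + 1, ?_, ?_⟩
  · intro u ρ hρ
    by_cases h : ∃ a, R u a
    · simp only [h, dif_pos]
      constructor
      · intro h1
        have : Nat.find h ≤ ρ := by omega
        exact hR _ _ _ (Nat.find_spec h) this
      · intro h1
        exact (min_le_left _ _).trans (Nat.find_min' h h1)
    · simp only [h, dif_neg, not_false_iff]
      constructor
      · intro h1; omega
      · intro h1; exact absurd ⟨_, h1⟩ h
  · intro u
    dsimp only
    split_ifs
    · exact min_le_right _ _
    · exact le_rfl

lemma trunc_lip {V : Type*} {R : V → ℕ → Prop} {d : ℕ} {g : V → ℕ}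
    (h1 : ∀ u ρ, ρ ≤ d → (g u ≤ ρ ↔ R u ρ)) (h2 : ∀ u, g u ≤ d + 1) {u w : V} {c : ℕ}
    (h : ∀ a, R u a → R w (a + c)) : g w ≤ g u + c := by
  by_cases hd : g u + c ≤ d
  · rw [h1 w _ hd]
    exact h _ ((h1 u _ (by omega)).1 le_rfl)
  · have := h2 w; omega

theorem ldd {V : Type*} [Fintype V] (E : V → V → Prop) (ℓ μ : V → V → ℕ)
    (hμ : ∀ u v, μ u v ≠ 0 → E u v) (d T : ℕ) (hT1 : 1 ≤ T)
    (hT : ∑ u, ∑ w, μ u w * ℓ u w < 2 ^ T) :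
    ∀ m : ℕ, ∀ A : Finset V, A.card ≤ m → ∃ f : V → ℕ,
      (∀ u ∈ A, ∀ w ∈ A, f u = f w → DLe (rel E A) ℓ u w (2 * d)) ∧
      (d + 1) * backW μ A f ≤ 2 * T * (Nat.log 2 A.card * ∑ u ∈ A, vvol μ ℓ u) := by
  intro m
  induction m with
  | zero =>
    intro A hA
    have : A = ∅ := Finset.card_eq_zero.1 (by omega)
    subst this
    exact ⟨fun _ => 0, by simp, by simp [backW]⟩
  | succ m ih =>
    intro A hA
    have hTA : ∑ u ∈ A, ∑ w ∈ A, μ u w * ℓ u w < 2 ^ T := by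
      refine lt_of_le_of_lt ?_ hT
      refine (Finset.sum_le_sum fun u _ =>
        Finset.sum_le_sum_of_subset (Finset.subset_univ A)).trans ?_
      exact Finset.sum_le_sum_of_subset (Finset.subset_univ A)
    -- recombination of a small cut piece and the rest
    have key : ∀ B : Finset V, B ⊆ A → B.Nonempty → 2 * B.card ≤ A.card → ∀ c : ℕ,
        (d + 1) * c ≤ 2 * T * ∑ u ∈ B, vvol μ ℓ u →
        ((c = ∑ u ∈ B, ∑ w ∈ A \ B, μ u w) ∨ (c = ∑ u ∈ A \ B, ∑ w ∈ B, μ u w)) →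
        ∃ f : V → ℕ, (∀ u ∈ A, ∀ w ∈ A, f u = f w → DLe (rel E A) ℓ u w (2 * d)) ∧
          (d + 1) * backW μ A f ≤ 2 * T * (Nat.log 2 A.card * ∑ u ∈ A, vvol μ ℓ u) := by
      intro B hBA hBne hB2 c hc hor
      have hB0 : 0 < B.card := hBne.card_pos
      have hsd : (A \ B).card = A.card - B.card := Finset.card_sdiff_of_subset hBA
      obtain ⟨f₁, p1, p2⟩ := ih B (by omega)
      obtain ⟨f₂, q1, q2⟩ := ih (A \ B) (by omega)
      have hlogB := log_half hB0 hB2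
      have hlogA : Nat.log 2 (A \ B).card ≤ Nat.log 2 A.card :=
        Nat.log_mono_right (by omega)
      have hsum : ∑ u ∈ A, vvol μ ℓ u = ∑ u ∈ A \ B, vvol μ ℓ u + ∑ u ∈ B, vvol μ ℓ u :=
        (Finset.sum_sdiff hBA).symm
      have hdd : Disjoint (A \ B) B := Finset.sdiff_disjoint
      have hun : A = A \ B ∪ B := (Finset.sdiff_union_of_subset hBA).symm
      have hex : ∃ f : V → ℕ, (∀ u ∈ A, ∀ w ∈ A, f u = f w →
          (u ∈ B ∧ w ∈ B ∧ f₁ u = f₁ w) ∨ (u ∈ A \ B ∧ w ∈ A \ B ∧ f₂ u = f₂ w)) ∧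
          backW μ A f = backW μ B f₁ + backW μ (A \ B) f₂ + c := by
        rcases hor with hc' | hc'
        · obtain ⟨f, r1, r2⟩ := merge_order μ A (A \ B) B hun hdd f₂ f₁
          exact ⟨f, fun u hu w hw h => (r1 u hu w hw h).symm, by rw [r2, ← hc']; ring⟩
        · obtain ⟨f, r1, r2⟩ := merge_order μ A B (A \ B) (by rw [Finset.union_comm]; exact hun)
            hdd.symm f₁ f₂
          exact ⟨f, r1, by rw [r2, ← hc']⟩
      obtain ⟨f, r1, r2⟩ := hex
      refine ⟨f, ?_, ?_⟩
      · intro u hu w hw huw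
        rcases r1 u hu w hw huw with ⟨a, b, e⟩ | ⟨a, b, e⟩
        · exact (p1 u a w b e).mono (rel_mono hBA) le_rfl
        · exact (q1 u a w b e).mono (rel_mono Finset.sdiff_subset) le_rfl
      · rw [r2, hsum]
        set X := ∑ u ∈ B, vvol μ ℓ u
        set Y := ∑ u ∈ A \ B, vvol μ ℓ u
        have e1 : Nat.log 2 B.card * X + X ≤ Nat.log 2 A.card * X := by
          rw [← Nat.succ_mul]; exact Nat.mul_le_mul_right _ hlogB
        have e2 : Nat.log 2 (A \ B).card * Y ≤ Nat.log 2 A.card * Y :=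
          Nat.mul_le_mul_right _ hlogA
        calc (d + 1) * (backW μ B f₁ + backW μ (A \ B) f₂ + c)
            = (d + 1) * backW μ B f₁ + (d + 1) * backW μ (A \ B) f₂ + (d + 1) * c := by ring
          _ ≤ 2 * T * (Nat.log 2 B.card * X) + 2 * T * (Nat.log 2 (A \ B).card * Y) + 2 * T * X :=
            add_le_add (add_le_add p2 q2) hc
          _ = 2 * T * (Nat.log 2 B.card * X + X + Nat.log 2 (A \ B).card * Y) := by ring
          _ ≤ 2 * T * (Nat.log 2 A.card * X + Nat.log 2 A.card * Y) :=
            Nat.mul_le_mul_left _ (add_le_add e1 e2)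
          _ = _ := by ring
    by_cases hout : ∃ v ∈ A, 2 * (A.filter (fun u => DLe (rel E A) ℓ v u d)).card ≤ A.card
    · obtain ⟨v, hv, hball⟩ := hout
      obtain ⟨g, hg1, hg2⟩ := exists_trunc (fun u ρ => DLe (rel E A) ℓ v u ρ)
        (fun u a b h hab => h.mono (fun _ _ h => h) hab) d
      obtain ⟨ρ, hρ, hcut⟩ := grow A g μ ℓ d T hT1 (by
        intro u hu w hw hm
        refine trunc_lip hg1 hg2 ?_
        intro a ha
        exact ha.trans (DLe.edge ⟨hu, hw, hμ _ _ hm⟩)) hTA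
      refine key (A.filter (fun u => g u ≤ ρ)) (Finset.filter_subset _ _)
        ⟨v, Finset.mem_filter.2 ⟨hv, (hg1 v ρ hρ).2 (DLe.refl v ρ)⟩⟩ ?_ _ ?_ (Or.inl rfl)
      · refine le_trans (Nat.mul_le_mul_left _ (Finset.card_le_card ?_)) hball
        intro u hu
        rw [Finset.mem_filter] at hu ⊢
        exact ⟨hu.1, ((hg1 u ρ hρ).1 hu.2).mono (fun _ _ h => h) hρ⟩
      · have e : A \ A.filter (fun u => g u ≤ ρ) = A.filter (fun w => ¬ g w ≤ ρ) := by
          ext x; simp only [Finset.mem_sdiff, Finset.mem_filter]; tauto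
        rw [e]
        refine hcut.trans (Nat.mul_le_mul_left _ (Finset.sum_le_sum fun u _ => ?_))
        unfold vvol
        refine (Finset.sum_le_sum_of_subset (Finset.subset_univ A)).trans ?_
        exact Finset.sum_le_sum fun w _ => Nat.le_add_right _ _
    by_cases hin : ∃ v ∈ A, 2 * (A.filter (fun u => DLe (rel E A) ℓ u v d)).card ≤ A.card
    · obtain ⟨v, hv, hball⟩ := hin
      obtain ⟨g, hg1, hg2⟩ := exists_trunc (fun u ρ => DLe (rel E A) ℓ u v ρ)
        (fun u a b h hab => h.mono (fun _ _ h => h) hab) d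
      obtain ⟨ρ, hρ, hcut⟩ := grow A g (fun u w => μ w u) (fun u w => ℓ w u) d T hT1 (by
        intro u hu w hw hm
        refine trunc_lip hg1 hg2 ?_
        intro a ha
        rw [add_comm]
        exact (DLe.edge ⟨hw, hu, hμ _ _ hm⟩ : DLe (rel E A) ℓ w u _).trans ha) (by
          rw [Finset.sum_comm]; exact hTA)
      refine key (A.filter (fun u => g u ≤ ρ)) (Finset.filter_subset _ _)
        ⟨v, Finset.mem_filter.2 ⟨hv, (hg1 v ρ hρ).2 (DLe.refl v ρ)⟩⟩ ?_ _ ?_ (Or.inr rfl)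
      · refine le_trans (Nat.mul_le_mul_left _ (Finset.card_le_card ?_)) hball
        intro u hu
        rw [Finset.mem_filter] at hu ⊢
        exact ⟨hu.1, ((hg1 u ρ hρ).1 hu.2).mono (fun _ _ h => h) hρ⟩
      · have e : A \ A.filter (fun u => g u ≤ ρ) = A.filter (fun w => ¬ g w ≤ ρ) := by
          ext x; simp only [Finset.mem_sdiff, Finset.mem_filter]; tauto
        rw [e, Finset.sum_comm]
        refine hcut.trans (Nat.mul_le_mul_left _ (Finset.sum_le_sum fun u _ => ?_))
        unfold vvol
        refine (Finset.sum_le_sum_of_subset (Finset.subset_univ A)).trans ?_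
        exact Finset.sum_le_sum fun w _ => Nat.le_add_left _ _
    · push Not at hout hin
      refine ⟨fun _ => 0, ?_, by simp [backW]⟩
      intro u hu w hw _
      have h1 := hout u hu
      have h2 := hin w hw
      have : ¬ Disjoint (A.filter (fun x => DLe (rel E A) ℓ u x d))
          (A.filter (fun x => DLe (rel E A) ℓ x w d)) := by
        intro hdis
        have h3 := Finset.card_union_of_disjoint hdis
        have h4 := Finset.card_le_card (Finset.union_subset
          (Finset.filter_subset (fun x => DLe (rel E A) ℓ u x d) A)
          (Finset.filter_subset (fun x => DLe (rel E A) ℓ x w d) A))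
        omega
      rw [Finset.not_disjoint_iff] at this
      obtain ⟨x, hx1, hx2⟩ := this
      have h3 := ((Finset.mem_filter.1 hx1).2).trans (Finset.mem_filter.1 hx2).2
      exact h3.mono (fun _ _ h => h) (by omega)

/-! ### Words -/

lemma seq_word {V : Type*} (g : V → ℕ) : ∀ m : ℕ, ∀ A : Finset V, A.card = m →
    ∃ w : List V, w.length = m ∧
      ∀ l : List V, l.Pairwise (fun x y => g x < g y) → (∀ x ∈ l, x ∈ A) → l.Sublist w := by
  intro m
  induction m with
  | zero =>
    intro A hA
    have : A = ∅ := Finset.card_eq_zero.1 hA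
    subst this
    refine ⟨[], rfl, ?_⟩
    intro l _ h
    cases l with
    | nil => exact List.Sublist.refl _
    | cons a l => exact absurd (h a (by simp)) (by simp)
  | succ m ih =>
    intro A hA
    obtain ⟨x, hx, hmax⟩ := Finset.exists_max_image A g (Finset.card_pos.1 (by omega))
    obtain ⟨w, hw, hl⟩ := ih (A.erase x) (by rw [Finset.card_erase_of_mem hx]; omega)
    refine ⟨w ++ [x], by simp [hw], ?_⟩
    intro l hp hm
    rcases List.eq_nil_or_concat l with rfl | ⟨l0, y, rfl⟩
    · simp
    · rw [List.concat_eq_append] at hp hm ⊢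
      rw [List.pairwise_append] at hp
      have hl0 : ∀ z ∈ l0, z ∈ A.erase x := by
        intro z hz
        have h1 := hp.2.2 z hz y (by simp)
        have h2 := hmax y (hm y (by simp))
        refine Finset.mem_erase.2 ⟨?_, hm z (by simp [hz])⟩
        rintro rfl
        omega
      by_cases hy : y = x
      · subst hy
        exact (hl l0 hp.1 hl0).append (List.Sublist.refl _)
      · refine (hl (l0 ++ [y]) ?_ ?_).trans (List.sublist_append_left _ _)
        · rw [List.pairwise_append]; exact hp
        · intro z hz
          rcases List.mem_append.1 hz with hz | hz
          · exact hl0 z hz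
          · have : z = y := by simpa using hz
            subst this
            exact Finset.mem_erase.2 ⟨hy, hm z (by simp)⟩

lemma walk_mem {V : Type*} {E : V → V → Prop} {A : Finset V} {s t : V} {l : List V}
    (hs : s ∈ A) (h : IsWalk (rel E A) s t l) : ∀ x ∈ s :: l, x ∈ A := by
  induction l generalizing s with
  | nil => intro x hx; simp at hx; subst hx; exact hs
  | cons a l ih =>
    intro x hx
    rcases List.mem_cons.1 hx with rfl | hx
    · exact hs
    · exact ih h.1.2.1 h.2 x hx

lemma walk_end_mem {V : Type*} {E : V → V → Prop} {s t : V} {l : List V}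
    (h : IsWalk E s t l) : t ∈ s :: l := by
  induction l generalizing s with
  | nil => simp [IsWalk] at h; simp [h]
  | cons a l ih => exact List.mem_cons_of_mem _ (ih h.2)

lemma out_path {V : Type*} {E : V → V → Prop} {ℓ : V → V → ℕ} (hpos : ∀ u v, E u v → 0 < ℓ u v)
    (c : V) : ∀ m : ℕ, ∀ t B, DLe E ℓ c t B → ndist E ℓ c t = m →
    ∃ l, IsWalk E c t l ∧ walkLen ℓ c l = m ∧
      (c :: l).Pairwise (fun x y => ndist E ℓ c x < ndist E ℓ c y) ∧
      ∀ x ∈ c :: l, ndist E ℓ c x ≤ m := by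
  intro m
  induction m using Nat.strong_induction_on with
  | _ m ih =>
    intro t B hB hm
    have hcc : ndist E ℓ c c = 0 := Nat.le_zero.1 (ndist_le (DLe.refl c 0))
    obtain ⟨l, hl, hlen⟩ := ndist_spec hB
    rcases List.eq_nil_or_concat l with rfl | ⟨l0, y, rfl⟩
    · have hct : c = t := hl
      subst hct
      refine ⟨[], rfl, by simp [walkLen]; omega, by simp, by simp; omega⟩
    · rw [List.concat_eq_append] at hl hlen
      obtain ⟨u, h1, h2⟩ := isWalk_append.1 hl
      have hy : y = t := h2.2
      subst hy
      rw [walkLen_append h1] at hlen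
      simp only [walkLen, add_zero] at hlen
      have hp := hpos _ _ h2.1
      have hd : DLe E ℓ c u (walkLen ℓ c l0) := ⟨l0, h1, le_rfl⟩
      have h3 := ndist_le hd
      have h4 := ndist_le ((ndist_spec hd).trans (DLe.edge h2.1))
      obtain ⟨l1, g1, g2, g3, g4⟩ := ih (ndist E ℓ c u) (by omega) u _ hd rfl
      refine ⟨l1 ++ [y], isWalk_append.2 ⟨u, g1, h2.1, rfl⟩, ?_, ?_, ?_⟩
      · rw [walkLen_append g1]; simp only [walkLen]; omega
      · rw [← List.cons_append, List.pairwise_append]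
        refine ⟨g3, by simp, ?_⟩
        intro x hx z hz
        have : z = y := by simpa using hz
        subst this
        have := g4 x hx
        omega
      · intro x hx
        rw [← List.cons_append, List.mem_append] at hx
        rcases hx with hx | hx
        · have := g4 x hx; omega
        · have : x = y := by simpa using hx
          subst this
          omega

lemma in_path {V : Type*} {E : V → V → Prop} {ℓ : V → V → ℕ} (hpos : ∀ u v, E u v → 0 < ℓ u v)
    (c : V) : ∀ m : ℕ, ∀ s B, DLe E ℓ s c B → ndist E ℓ s c = m →
    ∃ l, IsWalk E s c l ∧ walkLen ℓ s l = m ∧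
      (s :: l).Pairwise (fun x y => ndist E ℓ y c < ndist E ℓ x c) ∧
      ∀ x ∈ s :: l, ndist E ℓ x c ≤ m := by
  intro m
  induction m using Nat.strong_induction_on with
  | _ m ih =>
    intro s B hB hm
    have hcc : ndist E ℓ c c = 0 := Nat.le_zero.1 (ndist_le (DLe.refl c 0))
    obtain ⟨l, hl, hlen⟩ := ndist_spec hB
    rcases l with _ | ⟨u, l0⟩
    · have hct : s = c := hl
      subst hct
      refine ⟨[], rfl, by simp [walkLen]; omega, by simp, by simp; omega⟩
    · obtain ⟨h1, h2⟩ := hl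
      simp only [walkLen] at hlen
      have hp := hpos _ _ h1
      have hd : DLe E ℓ u c (walkLen ℓ u l0) := ⟨l0, h2, le_rfl⟩
      have h3 := ndist_le hd
      have h4 := ndist_le ((DLe.edge (ℓ := ℓ) h1).trans (ndist_spec hd))
      obtain ⟨l1, g1, g2, g3, g4⟩ := ih (ndist E ℓ u c) (by omega) u _ hd rfl
      refine ⟨u :: l1, ⟨h1, g1⟩, ?_, ?_, ?_⟩
      · simp only [walkLen]; omega
      · rw [List.pairwise_cons]
        refine ⟨?_, g3⟩
        intro x hx
        have := g4 x hx
        omega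
      · intro x hx
        rcases List.mem_cons.1 hx with rfl | hx
        · omega
        · have := g4 x hx; omega

/-- words containing the in-tree and out-tree of `c` -/
lemma tree_word {V : Type*} {E : V → V → Prop} {ℓ : V → V → ℕ} (hpos : ∀ u v, E u v → 0 < ℓ u v)
    (A : Finset V) (c : V) (hc : c ∈ A) : ∃ w : List V, w.length = 2 * A.card ∧
      ∀ s ∈ A, ∀ t ∈ A, ∀ B₁ B₂, DLe (rel E A) ℓ s c B₁ → DLe (rel E A) ℓ c t B₂ →
        ∃ l, IsWalk (rel E A) s t l ∧ (s :: l).Sublist w ∧ walkLen ℓ s l ≤ B₁ + B₂ := by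
  have hpos' : ∀ u v, rel E A u v → 0 < ℓ u v := fun u v h => hpos u v h.2.2
  obtain ⟨w1, h1, h1'⟩ := seq_word (fun x => ndist (rel E A) ℓ x c) _ A rfl
  obtain ⟨w2, h2, h2'⟩ := seq_word (fun x => ndist (rel E A) ℓ c x) _ A rfl
  refine ⟨w1.reverse ++ w2, by simp [h1, h2]; ring, ?_⟩
  intro s hs t ht B₁ B₂ hB1 hB2
  obtain ⟨l1, a1, a2, a3, -⟩ := in_path hpos' c _ s B₁ hB1 rfl
  obtain ⟨l2, b1, b2, b3, -⟩ := out_path hpos' c _ t B₂ hB2 rfl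
  have hb := ndist_le hB1
  have hb' := ndist_le hB2
  refine ⟨l1 ++ l2, isWalk_append.2 ⟨c, a1, b1⟩, ?_, ?_⟩
  · rw [← List.cons_append]
    refine List.Sublist.append ?_ ?_
    · have : (s :: l1).reverse.Sublist w1 := by
        refine h1' _ (List.pairwise_reverse.2 a3) ?_
        intro x hx
        exact walk_mem hs a1 x (List.mem_reverse.1 hx)
      have h := this.reverse
      rwa [List.reverse_reverse] at h
    · exact (List.sublist_cons_self c l2).trans (h2' _ b3 (walk_mem hc b1))
  · rw [walkLen_append a1]; omega

/-- shortest distances are bounded -/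
lemma ndist_bound {V : Type*} [Fintype V] {E : V → V → Prop} {ℓ : V → V → ℕ} {K : ℕ}
    (hpos : ∀ u v, E u v → 0 < ℓ u v ∧ ℓ u v ≤ K) {s t : V} {B : ℕ} (h : DLe E ℓ s t B) :
    ndist E ℓ s t ≤ Fintype.card V * K := by
  obtain ⟨l, h1, h2, h3, -⟩ := out_path (fun u v h => (hpos u v h).1) s _ t B h rfl
  rw [← h2]
  have hnd : (s :: l).Nodup := h3.imp (fun {a b} hab => by rintro rfl; omega)
  have hlen : (s :: l).length ≤ Fintype.card V := hnd.length_le_card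
  have key : ∀ (l : List V) (s : V), IsWalk E s t l → walkLen ℓ s l ≤ l.length * K := by
    intro l
    induction l with
    | nil => intro s _; simp [walkLen]
    | cons a l ih =>
      intro s hs
      have := ih a hs.2
      have := (hpos _ _ hs.1).2
      simp only [walkLen, List.length_cons, Nat.add_mul, one_mul]
      omega
  refine (key l s h1).trans (Nat.mul_le_mul_right _ ?_)
  simp at hlen
  omega

/-! ### Blocks -/

/-- `W` contains `a/b`-approximate shortest walks between all pairs in `A`. -/
def Good {V : Type*} (E : V → V → Prop) (ℓ : V → V → ℕ) (W : List V) (A : Finset V) (a b : ℕ) :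
    Prop :=
  ∀ s ∈ A, ∀ t ∈ A, ∀ B, DLe (rel E A) ℓ s t B →
    ∃ l, IsWalk (rel E A) s t l ∧ (s :: l).Sublist W ∧ b * walkLen ℓ s l ≤ a * B

/-- Number of backward steps of a walk. -/
def bk {V : Type*} (f : V → ℕ) (s : V) (l : List V) : ℕ :=
  walkLen (fun u v => if f v < f u then 1 else 0) s l

lemma cluster_split {V : Type*} {E : V → V → Prop} {A : Finset V} (f : V → ℕ) {t : V} (i : ℕ)
    (l : List V) : ∀ s, s ∈ A → f s = i → IsWalk (rel E A) s t l →
    (IsWalk (rel E (A.filter (fun x => f x = i))) s t l) ∨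
    (∃ l₁ u v l₂, l = l₁ ++ v :: l₂ ∧ IsWalk (rel E (A.filter (fun x => f x = i))) s u l₁ ∧
      f u = i ∧ f v ≠ i ∧ rel E A u v ∧ IsWalk (rel E A) v t l₂) := by
  induction l with
  | nil => intro s _ _ h; exact Or.inl h
  | cons a l ih =>
    intro s hs hi h
    by_cases ha : f a = i
    · have e : rel E (A.filter (fun x => f x = i)) s a :=
        ⟨Finset.mem_filter.2 ⟨hs, hi⟩, Finset.mem_filter.2 ⟨h.1.2.1, ha⟩, h.1.2.2⟩
      rcases ih a h.1.2.1 ha h.2 with h' | ⟨l₁, u, v, l₂, rfl, h1, h2, h3, h4, h5⟩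
      · exact Or.inl ⟨e, h'⟩
      · exact Or.inr ⟨a :: l₁, u, v, l₂, rfl, ⟨e, h1⟩, h2, h3, h4, h5⟩
    · exact Or.inr ⟨[], s, a, l, rfl, rfl, hi, ha, h.1, h.2⟩

lemma replicate_flatten_sublist {V : Type*} (X : List V) {m n : ℕ} (h : m ≤ n) :
    (List.replicate m X).flatten.Sublist (List.replicate n X).flatten := by
  obtain ⟨k, rfl⟩ := Nat.exists_eq_add_of_le h
  rw [List.replicate_add, List.flatten_append]
  exact List.sublist_append_left _ _

lemma block {V : Type*} {E : V → V → Prop} {ℓ : V → V → ℕ} {A : Finset V} {f : V → ℕ} {N : ℕ}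
    (hN : ∀ x ∈ A, f x < N) (Wd Bl : ℕ → List V) (hBl : ∀ i < N, Bl i = Wd i ++ Bl (i + 1))
    {a b : ℕ} (hba : b ≤ a) (S : V → Prop)
    (hS : ∀ x ∈ A, S x → Good E ℓ (Wd (f x)) (A.filter (fun y => f y = f x)) a b) {t : V} :
    ∀ m : ℕ, ∀ l : List V, l.length ≤ m → ∀ s, s ∈ A → IsWalk (rel E A) s t l →
      (∀ x ∈ s :: l, S x) →
      ∃ l', IsWalk (rel E A) s t l' ∧
        (s :: l').Sublist (Bl (f s) ++ (List.replicate (bk f s l) (Bl 0)).flatten) ∧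
        b * walkLen ℓ s l' ≤ a * walkLen ℓ s l := by
  have hmono : ∀ j i, i ≤ j → j ≤ N → (Bl j).Sublist (Bl i) := by
    intro j i hij
    induction hij with
    | refl => intro _; exact List.Sublist.refl _
    | @step k hij ih =>
      intro hj
      refine List.Sublist.trans ?_ (ih (by omega))
      rw [hBl k (by omega)]
      exact List.sublist_append_right _ _
  have hcl : ∀ i, ∀ u v, rel E (A.filter (fun x => f x = i)) u v → rel E A u v :=
    fun i => rel_mono (Finset.filter_subset _ _)
  intro m
  induction m with
  | zero =>
    intro l hl s hs hw hall
    have : l = [] := List.length_eq_zero_iff.1 (by omega)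
    subst this
    have hst : s = t := hw
    subst hst
    have hm : s ∈ A.filter (fun y => f y = f s) := Finset.mem_filter.2 ⟨hs, rfl⟩
    obtain ⟨l', h1, h2, h3⟩ := hS s hs (hall s (by simp)) s hm s hm 0 (DLe.refl s 0)
    refine ⟨l', isWalk_mono (hcl _) h1, ?_, h3⟩
    refine h2.trans ?_
    rw [hBl _ (hN s hs), List.append_assoc]
    exact List.sublist_append_left _ _
  | succ m ih =>
    intro l hl s hs hw hall
    have hm : s ∈ A.filter (fun y => f y = f s) := Finset.mem_filter.2 ⟨hs, rfl⟩
    rcases cluster_split f (f s) l s hs rfl hw with h | ⟨l₁, u, v, l₂, rfl, h1, h2, h3, h4, h5⟩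
    · have ht := walk_mem hm h t (walk_end_mem h)
      obtain ⟨l', g1, g2, g3⟩ := hS s hs (hall s (by simp)) s hm t ht _ ⟨l, h, le_rfl⟩
      refine ⟨l', isWalk_mono (hcl _) g1, ?_, g3⟩
      refine g2.trans ?_
      rw [hBl _ (hN s hs), List.append_assoc]
      exact List.sublist_append_left _ _
    · have hu := walk_mem hm h1 u (walk_end_mem h1)
      obtain ⟨l₁', g1, g2, g3⟩ := hS s hs (hall s (by simp)) s hm u hu _ ⟨l₁, h1, le_rfl⟩
      have hlen : l₂.length ≤ m := by
        simp at hl; omega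
      obtain ⟨l₂', k1, k2, k3⟩ := ih l₂ hlen v h4.2.1 h5 (by
        intro x hx
        apply hall
        rw [← List.cons_append]
        exact List.mem_append_right _ hx)
      refine ⟨l₁' ++ v :: l₂', isWalk_append.2 ⟨u, isWalk_mono (hcl _) g1, h4, k1⟩, ?_, ?_⟩
      · rw [← List.cons_append]
        refine (g2.append k2).trans ?_
        have hb : bk f s (l₁ ++ v :: l₂) = bk f s l₁ + ((if f v < f u then 1 else 0) + bk f v l₂) := by
          unfold bk
          rw [walkLen_append h1]
          rfl
        by_cases hv : f v < f u
        · rw [if_pos hv] at hb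
          refine List.Sublist.trans ?_ (List.Sublist.append (List.Sublist.refl _)
            (replicate_flatten_sublist (Bl 0) (show bk f v l₂ + 1 ≤ bk f s (l₁ ++ v :: l₂) by omega)))
          rw [List.replicate_succ, List.flatten_cons]
          refine List.Sublist.append ?_ (List.Sublist.append ?_ (List.Sublist.refl _))
          · rw [hBl _ (hN s hs)]; exact List.sublist_append_left _ _
          · exact hmono _ _ (Nat.zero_le _) (hN v h4.2.1).le
        · refine List.Sublist.trans ?_ (List.Sublist.append (List.Sublist.refl _)
            (replicate_flatten_sublist (Bl 0) (show bk f v l₂ ≤ bk f s (l₁ ++ v :: l₂) by omega)))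
          rw [hBl _ (hN s hs), List.append_assoc]
          refine List.Sublist.append (List.Sublist.refl _)
            (List.Sublist.append ?_ (List.Sublist.refl _))
          exact hmono _ _ (by omega) (hN v h4.2.1).le
      · rw [walkLen_append g1, walkLen_append h1]
        simp only [walkLen]
        have := Nat.mul_le_mul_right (ℓ u v) hba
        simp only [Nat.mul_add]
        omega

lemma first_bad {V : Type*} {E : V → V → Prop} {t : V} (S : V → Prop)
    (l : List V) : ∀ s, IsWalk E s t l →
    (∀ x ∈ s :: l, S x) ∨ ¬ S s ∨
    (∃ l₁ u v l₂, l = l₁ ++ v :: l₂ ∧ IsWalk E s u l₁ ∧ (∀ x ∈ s :: l₁, S x) ∧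
      ¬ S v ∧ E u v ∧ IsWalk E v t l₂) := by
  induction l with
  | nil =>
    intro s h
    by_cases hs : S s
    · left; simpa using hs
    · right; left; exact hs
  | cons a l ih =>
    intro s h
    by_cases hs : S s
    · rcases ih a h.2 with h1 | h1 | ⟨l₁, u, v, l₂, rfl, h1, h2, h3, h4, h5⟩
      · left
        intro x hx
        rcases List.mem_cons.1 hx with rfl | hx
        · exact hs
        · exact h1 x hx
      · right; right
        exact ⟨[], s, a, l, rfl, rfl, by simpa using hs, h1, h.1, h.2⟩
      · right; right
        refine ⟨a :: l₁, u, v, l₂, rfl, ⟨h.1, h1⟩, ?_, h3, h4, h5⟩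
        intro x hx
        rcases List.mem_cons.1 hx with rfl | hx
        · exact hs
        · exact h2 x hx
    · right; left; exact hs

lemma walkLen_eq_sum {V : Type*} [Fintype V] (h : V → V → ℕ) (l : List V) : ∀ s : V,
    walkLen h s l = ∑ u, ∑ v, walkLen (fun x y => if x = u ∧ y = v then 1 else 0) s l * h u v := by
  induction l with
  | nil => intro s; simp [walkLen]
  | cons a l ih =>
    intro s
    simp only [walkLen, Nat.add_mul, Finset.sum_add_distrib]
    rw [← ih a]
    congr 1
    rw [Finset.sum_eq_single s, Finset.sum_eq_single a]
    · simp
    · intro b _ hb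
      simp [Ne.symm hb]
    · simp
    · intro b _ hb
      simp [Ne.symm hb]
    · simp

lemma walkLen_ind_ne {V : Type*} {E : V → V → Prop} {t u v : V} (l : List V) : ∀ s : V,
    IsWalk E s t l → walkLen (fun x y => if x = u ∧ y = v then 1 else 0) s l ≠ 0 → E u v := by
  induction l with
  | nil => intro s _ h; simp [walkLen] at h
  | cons a l ih =>
    intro s hs h
    by_cases hc : s = u ∧ a = v
    · obtain ⟨rfl, rfl⟩ := hc
      exact hs.1
    · simp only [walkLen, if_neg hc, zero_add] at h
      exact ih a hs.2 h

/-! ### One decomposition step -/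

lemma exists_blocks {V : Type*} (Wd : ℕ → List V) (N : ℕ) : ∃ Bl : ℕ → List V,
    (∀ i < N, Bl i = Wd i ++ Bl (i + 1)) ∧
    (Bl 0).length = ∑ i ∈ Finset.range N, (Wd i).length := by
  refine ⟨fun i => ((List.range' i (N - i)).map Wd).flatten, ?_, ?_⟩
  · intro i hi
    have e : N - i = (N - (i + 1)) + 1 := by omega
    dsimp only
    rw [e, List.range'_succ, List.map_cons, List.flatten_cons]
  · dsimp only
    rw [Nat.sub_zero, ← List.range_eq_range']
    induction N with
    | zero => simp
    | succ N ih =>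
      rw [List.range_succ, List.map_append, List.flatten_append, List.length_append, ih,
        Finset.sum_range_succ]
      simp

lemma length_flatten_le {V : Type*} (X : ℕ) (L : List (List V)) (h : ∀ w ∈ L, w.length ≤ X) :
    L.flatten.length ≤ L.length * X := by
  induction L with
  | nil => simp
  | cons w L ih =>
    have h1 := h w (by simp)
    have h2 := ih (fun w hw => h w (by simp [hw]))
    rw [List.flatten_cons, List.length_append, List.length_cons, Nat.add_mul]
    omega

lemma assemble {V : Type*} {E : V → V → Prop} {ℓ : V → V → ℕ}
    (hpos : ∀ u v, E u v → 0 < ℓ u v) (A : Finset V) (f : V → ℕ) (d R e a b m M K : ℕ)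
    (hba : b ≤ a) (hf : ∀ u ∈ A, ∀ w ∈ A, f u = f w → DLe (rel E A) ℓ u w (2 * d))
    (hA : A.card ≤ M * m)
    (hrec : ∀ A' : Finset V, A'.card ≤ m → ∃ W : List V, W.length ≤ A'.card * K ∧ Good E ℓ W A' a b) :
    ∃ W : List V, W.length ≤ (R + 1) * (A.card * K) + M * (2 * A.card) ∧
      ∀ s ∈ A, ∀ t ∈ A, ∀ l, IsWalk (rel E A) s t l → bk f s l ≤ R →
        4 * e * d ≤ walkLen ℓ s l →
        ∃ l', IsWalk (rel E A) s t l' ∧ (s :: l').Sublist W ∧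
          (e * b) * walkLen ℓ s l' ≤ ((e + 1) * a) * walkLen ℓ s l := by
  set N := A.sup f + 1 with hNdef
  have hN : ∀ x ∈ A, f x < N := fun x hx => Nat.lt_succ_of_le (Finset.le_sup hx)
  set cl : ℕ → Finset V := fun i => A.filter (fun y => f y = i) with hcl
  have hsum : ∑ i ∈ Finset.range N, (cl i).card = A.card := by
    symm
    exact Finset.card_eq_sum_card_fiberwise (fun x hx => by simpa using hN x hx)
  have hW : ∀ i, ∃ W : List V, W.length ≤ (cl i).card * K ∧
      ((cl i).card ≤ m → Good E ℓ W (cl i) a b) := by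
    intro i
    by_cases h : (cl i).card ≤ m
    · obtain ⟨W, h1, h2⟩ := hrec _ h
      exact ⟨W, h1, fun _ => h2⟩
    · exact ⟨[], by simp, fun h' => absurd h' h⟩
  choose Wd hWd1 hWd2 using hW
  obtain ⟨Bl, hBl, hBl0⟩ := exists_blocks Wd N
  have hBlen : (Bl 0).length ≤ A.card * K := by
    rw [hBl0, ← hsum, Finset.sum_mul]
    exact Finset.sum_le_sum fun i _ => hWd1 i
  have hT : ∀ i, ∃ w : List V, w.length ≤ 2 * A.card ∧ (m < (cl i).card →
      ∀ v ∈ cl i, ∀ t ∈ A, ∀ r, DLe (rel E A) ℓ v t r →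
        ∃ l, IsWalk (rel E A) v t l ∧ (v :: l).Sublist w ∧ walkLen ℓ v l ≤ 4 * d + r) := by
    intro i
    by_cases h : m < (cl i).card
    · obtain ⟨c, hc⟩ := Finset.card_pos.1 (by omega : 0 < (cl i).card)
      obtain ⟨hcA, hci⟩ := Finset.mem_filter.1 hc
      obtain ⟨w, hw, hw'⟩ := tree_word hpos A c hcA
      refine ⟨w, hw.le, fun _ v hv t ht r hr => ?_⟩
      obtain ⟨hvA, hvi⟩ := Finset.mem_filter.1 hv
      obtain ⟨l, h1, h2, h3⟩ := hw' v hvA t ht _ _ (hf v hvA c hcA (by rw [hvi, hci]))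
        ((hf c hcA v hvA (by rw [hvi, hci])).trans hr)
      exact ⟨l, h1, h2, by omega⟩
    · exact ⟨[], by simp, fun h' => absurd h' h⟩
  choose Tw hTw1 hTw2 using hT
  set big := (Finset.range N).filter (fun i => m < (cl i).card) with hbig
  have hbigcard : big.card ≤ M := by
    have h1 : big.card * (m + 1) ≤ ∑ i ∈ big, (cl i).card := by
      rw [← smul_eq_mul]
      refine Finset.card_nsmul_le_sum _ _ _ ?_
      intro i hi
      exact (Finset.mem_filter.1 hi).2
    have h2 : ∑ i ∈ big, (cl i).card ≤ A.card := by
      rw [← hsum]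
      exact Finset.sum_le_sum_of_subset (Finset.filter_subset _ _)
    by_contra hcon
    push Not at hcon
    have h3 : (M + 1) * (m + 1) ≤ big.card * (m + 1) := Nat.mul_le_mul_right _ hcon
    nlinarith
  set Tr := (big.toList.map Tw).flatten with hTr
  have hTrlen : Tr.length ≤ M * (2 * A.card) := by
    refine (length_flatten_le (2 * A.card) _ ?_).trans ?_
    · intro w hw
      obtain ⟨i, -, rfl⟩ := List.mem_map.1 hw
      exact hTw1 i
    · rw [List.length_map, Finset.length_toList]
      exact Nat.mul_le_mul_right _ hbigcard
  have hTrw : ∀ v ∈ A, m < (cl (f v)).card → ∀ t ∈ A, ∀ r, DLe (rel E A) ℓ v t r →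
        ∃ l, IsWalk (rel E A) v t l ∧ (v :: l).Sublist Tr ∧ walkLen ℓ v l ≤ 4 * d + r := by
    intro v hv hm t ht r hr
    obtain ⟨l, h1, h2, h3⟩ := hTw2 _ hm v (Finset.mem_filter.2 ⟨hv, rfl⟩) t ht r hr
    refine ⟨l, h1, h2.trans ?_, h3⟩
    apply List.sublist_flatten_of_mem
    refine List.mem_map.2 ⟨f v, ?_, rfl⟩
    rw [Finset.mem_toList]
    exact Finset.mem_filter.2 ⟨Finset.mem_range.2 (hN v hv), hm⟩
  have hmono : ∀ i, i ≤ N → (Bl i).Sublist (Bl 0) := by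
    intro i
    induction i with
    | zero => intro _; exact List.Sublist.refl _
    | succ i ih =>
      intro hi
      refine List.Sublist.trans ?_ (ih (by omega))
      rw [hBl i (by omega)]
      exact List.sublist_append_right _ _
  set S : V → Prop := fun x => (cl (f x)).card ≤ m with hS
  have hblk : ∀ t s l, s ∈ A → IsWalk (rel E A) s t l → (∀ x ∈ s :: l, S x) → bk f s l ≤ R →
      ∃ l', IsWalk (rel E A) s t l' ∧ (s :: l').Sublist (List.replicate (R + 1) (Bl 0)).flatten ∧
        b * walkLen ℓ s l' ≤ a * walkLen ℓ s l := by
    intro t s l hs hw hall hR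
    obtain ⟨l', h1, h2, h3⟩ := block hN Wd Bl hBl hba S (fun x _ hx => hWd2 _ hx) l.length l le_rfl
      s hs hw hall
    refine ⟨l', h1, h2.trans ?_, h3⟩
    rw [List.replicate_succ, List.flatten_cons]
    exact List.Sublist.append (hmono _ (hN s hs).le) (replicate_flatten_sublist _ hR)
  refine ⟨(List.replicate (R + 1) (Bl 0)).flatten ++ Tr, ?_, ?_⟩
  · rw [List.length_append]
    refine Nat.add_le_add ?_ hTrlen
    refine (length_flatten_le (A.card * K) _ ?_).trans ?_
    · intro w hw
      rw [List.eq_of_mem_replicate hw]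
      exact hBlen
    · rw [List.length_replicate]
  · intro s hs t ht l hw hR hd
    rcases first_bad S l s hw with h | h | ⟨l₁, u, v, l₂, rfl, h1, h2, h3, h4, h5⟩
    · obtain ⟨l', g1, g2, g3⟩ := hblk t s l hs hw h hR
      refine ⟨l', g1, g2.trans (List.sublist_append_left _ _), ?_⟩
      nlinarith
    · obtain ⟨l', g1, g2, g3⟩ := hTrw s hs (not_le.1 h) t ht _ ⟨l, hw, le_rfl⟩
      refine ⟨l', g1, g2.trans (List.sublist_append_right _ _), ?_⟩
      calc (e * b) * walkLen ℓ s l' ≤ (e * b) * (4 * d + walkLen ℓ s l) := Nat.mul_le_mul_left _ g3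
        _ = b * (4 * e * d) + (e * b) * walkLen ℓ s l := by ring
        _ ≤ a * walkLen ℓ s l + (e * a) * walkLen ℓ s l :=
            Nat.add_le_add (Nat.mul_le_mul hba hd)
              (Nat.mul_le_mul_right _ (Nat.mul_le_mul_left _ hba))
        _ = _ := by ring
    · have hbk : bk f s l₁ ≤ R := by
        refine le_trans ?_ hR
        unfold bk
        rw [walkLen_append h1]
        exact Nat.le_add_right _ _
      obtain ⟨l₁', g1, g2, g3⟩ := hblk u s l₁ hs h1 h2 hbk
      obtain ⟨l₂', k1, k2, k3⟩ := hTrw v h4.2.1 (not_le.1 h3) t ht _ ⟨l₂, h5, le_rfl⟩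
      refine ⟨l₁' ++ v :: l₂', isWalk_append.2 ⟨u, g1, h4, k1⟩, ?_, ?_⟩
      · rw [← List.cons_append]
        exact g2.append k2
      · rw [walkLen_append g1]
        rw [walkLen_append h1] at hd ⊢
        simp only [walkLen] at hd ⊢
        set x1 := walkLen ℓ s l₁'
        set y1 := walkLen ℓ s l₁
        set x2 := walkLen ℓ v l₂'
        set y2 := walkLen ℓ v l₂
        set z := ℓ u v
        calc (e * b) * (x1 + (z + x2)) ≤ (e * b) * (x1 + (z + (4 * d + y2))) := by gcongr
          _ = e * (b * x1) + b * (4 * e * d) + (e * b) * (z + y2) := by ring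
          _ ≤ e * (a * y1) + a * (y1 + (z + y2)) + (e * a) * (z + y2) := by gcongr
          _ = _ := by ring

lemma ldd_walks {V : Type*} [Fintype V] (E : V → V → Prop) (ℓ : V → V → ℕ) (A : Finset V)
    (Q : Finset (V × V)) (π : V × V → List V) (D e T Λ : ℕ) (hT1 : 1 ≤ T) (he : 1 ≤ e)
    (hQ : ∀ q ∈ Q, IsWalk (rel E A) q.1 q.2 (π q) ∧ D ≤ walkLen ℓ q.1 (π q) ∧
      walkLen ℓ q.1 (π q) ≤ 2 * D) (hQT : Q.card * (2 * D) < 2 ^ T) (hΛ : Nat.log 2 A.card ≤ Λ) :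
    ∃ (f : V → ℕ) (d : ℕ), 4 * e * d ≤ D ∧
      (∀ u ∈ A, ∀ w ∈ A, f u = f w → DLe (rel E A) ℓ u w (2 * d)) ∧
      ∑ q ∈ Q, bk f q.1 (π q) ≤ 32 * T * Λ * e * Q.card := by
  set μ : V → V → ℕ := fun u v =>
    ∑ q ∈ Q, walkLen (fun x y => if x = u ∧ y = v then 1 else 0) q.1 (π q) with hμ
  have hμr : ∀ u v, μ u v ≠ 0 → rel E A u v := by
    intro u v h
    obtain ⟨q, hq, hne⟩ := Finset.exists_ne_zero_of_sum_ne_zero h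
    exact walkLen_ind_ne _ _ (hQ q hq).1 hne
  have hsum : ∀ h : V → V → ℕ, ∑ u, ∑ v, μ u v * h u v = ∑ q ∈ Q, walkLen h q.1 (π q) := by
    intro h
    simp only [hμ, Finset.sum_mul]
    rw [Finset.sum_congr rfl (fun q _ => walkLen_eq_sum h (π q) q.1)]
    symm
    rw [Finset.sum_comm]
    exact Finset.sum_congr rfl fun u _ => Finset.sum_comm
  have htot : ∑ u, ∑ v, μ u v * ℓ u v ≤ Q.card * (2 * D) := by
    rw [hsum]
    rw [← smul_eq_mul]
    exact Finset.sum_le_card_nsmul _ _ _ (fun q hq => (hQ q hq).2.2)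
  set d := D / (4 * e) with hd
  obtain ⟨f, hf1, hf2⟩ := ldd E ℓ μ (fun u v h => (hμr u v h).2.2) d T hT1 (lt_of_le_of_lt htot hQT)
    A.card A le_rfl
  refine ⟨f, d, Nat.mul_div_le _ _, hf1, ?_⟩
  have hDd : D ≤ 4 * e * (d + 1) := (Nat.lt_mul_div_succ D (by omega : 0 < 4 * e)).le
  have hback : backW μ A f = ∑ q ∈ Q, bk f q.1 (π q) := by
    unfold bk
    rw [← hsum]
    unfold backW
    rw [← Finset.sum_subset (Finset.subset_univ A)]
    · refine Finset.sum_congr rfl fun u _ => ?_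
      rw [← Finset.sum_subset (Finset.subset_univ A)]
      · refine Finset.sum_congr rfl fun v _ => ?_
        split_ifs <;> simp
      · intro v _ hv
        have : μ u v = 0 := by
          by_contra h
          exact hv (hμr u v h).2.1
        simp [this]
    · intro u _ hu
      refine Finset.sum_eq_zero fun v _ => ?_
      have : μ u v = 0 := by
        by_contra h
        exact hu (hμr u v h).1
      simp [this]
  have hvv : ∑ u ∈ A, vvol μ ℓ u ≤ 2 * (Q.card * (2 * D)) := by
    refine (Finset.sum_le_sum_of_subset (Finset.subset_univ A)).trans ?_
    unfold vvol
    simp only [Finset.sum_add_distrib]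
    rw [Finset.sum_comm (f := fun u w => μ w u * ℓ w u)]
    omega
  rw [← hback]
  refine Nat.le_of_mul_le_mul_left (c := d + 1) ?_ (Nat.succ_pos d)
  calc (d + 1) * backW μ A f ≤ _ := hf2
    _ ≤ 2 * T * (Λ * (2 * (Q.card * (2 * (4 * e * (d + 1)))))) := by
      gcongr
      exact hvv.trans (by gcongr)
    _ = _ := by ring

lemma step_one {V : Type*} [Fintype V] (E : V → V → Prop) (ℓ : V → V → ℕ)
    (hpos : ∀ u v, E u v → 0 < ℓ u v) (A : Finset V) (Q : Finset (V × V)) (π : V × V → List V)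
    (D e T Λ a b m M K : ℕ) (hT1 : 1 ≤ T) (he : 1 ≤ e)
    (hQA : ∀ q ∈ Q, q.1 ∈ A ∧ q.2 ∈ A)
    (hQ : ∀ q ∈ Q, IsWalk (rel E A) q.1 q.2 (π q) ∧ D ≤ walkLen ℓ q.1 (π q) ∧
      walkLen ℓ q.1 (π q) ≤ 2 * D) (hQT : Q.card * (2 * D) < 2 ^ T) (hΛ : Nat.log 2 A.card ≤ Λ)
    (hba : b ≤ a) (hA : A.card ≤ M * m)
    (hrec : ∀ A' : Finset V, A'.card ≤ m →
      ∃ W : List V, W.length ≤ A'.card * K ∧ Good E ℓ W A' a b) :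
    ∃ (W : List V) (Q' : Finset (V × V)), Q' ⊆ Q ∧ 2 * Q'.card ≤ Q.card ∧
      W.length ≤ (2 * (32 * T * Λ * e) + 1) * (A.card * K) + M * (2 * A.card) ∧
      ∀ q ∈ Q, q ∉ Q' → ∃ l', IsWalk (rel E A) q.1 q.2 l' ∧ (q.1 :: l').Sublist W ∧
          (e * b) * walkLen ℓ q.1 l' ≤ ((e + 1) * a) * walkLen ℓ q.1 (π q) := by
  obtain ⟨f, d, h1, h2, h3⟩ := ldd_walks E ℓ A Q π D e T Λ hT1 he hQ hQT hΛ
  set R0 := 32 * T * Λ * e with hR0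
  obtain ⟨W, hW1, hW2⟩ := assemble hpos A f d (2 * R0) e a b m M K hba h2 hA hrec
  refine ⟨W, Q.filter (fun q => 2 * R0 < bk f q.1 (π q)), Finset.filter_subset _ _, ?_, hW1, ?_⟩
  · set Q' := Q.filter (fun q => 2 * R0 < bk f q.1 (π q)) with hQ'
    have : Q'.card * (2 * R0 + 1) ≤ R0 * Q.card := by
      refine le_trans ?_ h3
      refine le_trans ?_ (Finset.sum_le_sum_of_subset
        (Finset.filter_subset (fun q => 2 * R0 < bk f q.1 (π q)) Q))
      rw [← smul_eq_mul]
      exact Finset.card_nsmul_le_sum _ _ _ (fun q hq => (Finset.mem_filter.1 hq).2)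
    by_contra hcon
    push Not at hcon
    nlinarith
  · intro q hq hq'
    have hb : bk f q.1 (π q) ≤ 2 * R0 := by
      by_contra hcon
      exact hq' (Finset.mem_filter.2 ⟨hq, not_le.1 hcon⟩)
    exact hW2 q.1 (hQA q hq).1 q.2 (hQA q hq).2 _ (hQ q hq).1 hb (h1.trans (hQ q hq).2.1)

/-! ### The universal word -/

lemma rounds {α β : Type*} (cov : α → List β → Prop)
    (hcov : ∀ q W W', List.Sublist W W' → cov q W → cov q W') (X : ℕ) (Q₀ : Finset α)
    (H : ∀ Q ⊆ Q₀, ∃ (W : List β) (Q' : Finset α), Q' ⊆ Q ∧ 2 * Q'.card ≤ Q.card ∧ W.length ≤ X ∧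
      ∀ q ∈ Q, q ∉ Q' → cov q W) :
    ∀ ρ : ℕ, ∀ Q ⊆ Q₀, Q.card < 2 ^ ρ → ∃ W : List β, W.length ≤ ρ * X ∧ ∀ q ∈ Q, cov q W := by
  intro ρ
  induction ρ with
  | zero =>
    intro Q _ hc
    have : Q = ∅ := Finset.card_eq_zero.1 (by simp at hc; simp [hc])
    subst this
    exact ⟨[], by simp, by simp⟩
  | succ ρ ih =>
    intro Q hQ hc
    obtain ⟨W, Q', h1, h2, h3, h4⟩ := H Q hQ
    obtain ⟨W', g1, g2⟩ := ih Q' (h1.trans hQ) (by rw [pow_succ] at hc; omega)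
    refine ⟨W ++ W', by rw [List.length_append, Nat.add_mul, one_mul]; omega, ?_⟩
    intro q hq
    by_cases hq' : q ∈ Q'
    · exact hcov _ _ _ (List.sublist_append_right _ _) (g2 q hq')
    · exact hcov _ _ _ (List.sublist_append_left _ _) (h4 q hq hq')

lemma scales {α β : Type*} (cov : α → List β → Prop)
    (hcov : ∀ q W W', List.Sublist W W' → cov q W → cov q W') (Y : ℕ) (Q : ℕ → Finset α) (J : ℕ)
    (H : ∀ i < J, ∃ W : List β, W.length ≤ Y ∧ ∀ q ∈ Q i, cov q W) :
    ∃ W : List β, W.length ≤ J * Y ∧ ∀ i < J, ∀ q ∈ Q i, cov q W := by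
  induction J with
  | zero => exact ⟨[], by simp, by simp⟩
  | succ J ih =>
    obtain ⟨W, h1, h2⟩ := ih (fun i hi => H i (by omega))
    obtain ⟨W', g1, g2⟩ := H J (by omega)
    refine ⟨W ++ W', by rw [List.length_append, Nat.add_mul, one_mul]; omega, ?_⟩
    intro i hi q hq
    by_cases hiJ : i = J
    · subst hiJ
      exact hcov _ _ _ (List.sublist_append_right _ _) (g2 q hq)
    · exact hcov _ _ _ (List.sublist_append_left _ _) (h2 i (by omega) q hq)

lemma universal_step {V : Type*} [Fintype V] (E : V → V → Prop) (ℓ : V → V → ℕ)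
    (hpos : ∀ u v, E u v → 0 < ℓ u v) (A : Finset V)
    (e ρ J Λ a b m M K : ℕ) (he : 1 ≤ e) (hJ1 : 1 ≤ J)
    (hρ : Fintype.card V * Fintype.card V < 2 ^ ρ)
    (hJ : ∀ s t B, DLe (rel E A) ℓ s t B → ndist (rel E A) ℓ s t < 2 ^ J)
    (hΛ : Nat.log 2 A.card ≤ Λ)
    (hba : b ≤ a) (hA : A.card ≤ M * m)
    (hrec : ∀ A' : Finset V, A'.card ≤ m →
      ∃ W : List V, W.length ≤ A'.card * K ∧ Good E ℓ W A' a b) :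
    ∃ W : List V, W.length ≤ A.card + J * (ρ * ((2 * (32 * (ρ + J) * Λ * e) + 1) * (A.card * K) +
      M * (2 * A.card))) ∧ Good E ℓ W A ((e + 1) * a) (e * b) := by
  set cov : V × V → List V → Prop := fun q W => ∃ l', IsWalk (rel E A) q.1 q.2 l' ∧
    (q.1 :: l').Sublist W ∧
    (e * b) * walkLen ℓ q.1 l' ≤ ((e + 1) * a) * ndist (rel E A) ℓ q.1 q.2 with hcovdef
  have hcov : ∀ q W W', List.Sublist W W' → cov q W → cov q W' := by
    rintro q W W' hs ⟨l', h1, h2, h3⟩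
    exact ⟨l', h1, h2.trans hs, h3⟩
  have hπ : ∀ q : V × V, ∃ l, (∃ B, DLe (rel E A) ℓ q.1 q.2 B) → IsWalk (rel E A) q.1 q.2 l ∧
      walkLen ℓ q.1 l = ndist (rel E A) ℓ q.1 q.2 := by
    intro q
    by_cases h : ∃ B, DLe (rel E A) ℓ q.1 q.2 B
    · obtain ⟨B, hB⟩ := h
      obtain ⟨l, h1, h2⟩ := ndist_spec hB
      exact ⟨l, fun _ => ⟨h1, le_antisymm h2 (ndist_le ⟨l, h1, le_rfl⟩)⟩⟩
    · exact ⟨[], fun h' => absurd h' h⟩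
  choose π hπ using hπ
  set Q : ℕ → Finset (V × V) := fun i => (A ×ˢ A).filter (fun q =>
    (∃ B, DLe (rel E A) ℓ q.1 q.2 B) ∧ 2 ^ i ≤ ndist (rel E A) ℓ q.1 q.2 ∧
      ndist (rel E A) ℓ q.1 q.2 ≤ 2 * 2 ^ i) with hQ
  have hcard : ∀ Q' : Finset (V × V), Q'.card < 2 ^ ρ := by
    intro Q'
    refine lt_of_le_of_lt (Finset.card_le_univ _) ?_
    rwa [Fintype.card_prod]
  obtain ⟨W, hW1, hW2⟩ := scales cov hcov
    (ρ * ((2 * (32 * (ρ + J) * Λ * e) + 1) * (A.card * K) + M * (2 * A.card))) Q J (by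
      intro i hi
      refine rounds cov hcov _ (Q i) ?_ ρ (Q i) (Finset.Subset.refl _) (hcard _)
      intro Q' hQ'
      have hmem : ∀ q ∈ Q', (q.1 ∈ A ∧ q.2 ∈ A) ∧ (∃ B, DLe (rel E A) ℓ q.1 q.2 B) ∧
          2 ^ i ≤ ndist (rel E A) ℓ q.1 q.2 ∧ ndist (rel E A) ℓ q.1 q.2 ≤ 2 * 2 ^ i := by
        intro q hq
        have := Finset.mem_filter.1 (hQ' hq)
        exact ⟨Finset.mem_product.1 this.1, this.2⟩
      obtain ⟨W, Q'', h1, h2, h3, h4⟩ := step_one E ℓ hpos A Q' π (2 ^ i) e (ρ + J) Λ a b m M K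
        (by omega) he (fun q hq => (hmem q hq).1) (by
          intro q hq
          obtain ⟨-, g1, g2, g3⟩ := hmem q hq
          obtain ⟨g4, g5⟩ := hπ q g1
          rw [g5]
          exact ⟨g4, g2, g3⟩) (by
          rw [pow_add]
          have e1 : 2 * 2 ^ i ≤ 2 ^ J := by
            rw [← pow_succ']
            exact Nat.pow_le_pow_right (by norm_num) hi
          exact Nat.mul_lt_mul_of_lt_of_le (hcard Q') e1 (by positivity)) hΛ hba hA hrec
      refine ⟨W, Q'', h1, h2, h3, ?_⟩
      intro q hq hq'
      obtain ⟨l', k1, k2, k3⟩ := h4 q hq hq'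
      rw [(hπ q (hmem q hq).2.1).2] at k3
      exact ⟨l', k1, k2, k3⟩)
  refine ⟨A.toList ++ W, by rw [List.length_append, Finset.length_toList]; omega, ?_⟩
  intro s hs t ht B hB
  by_cases hst : s = t
  · subst hst
    refine ⟨[], rfl, ?_, by simp [walkLen]⟩
    refine List.Sublist.trans ?_ (List.sublist_append_left _ _)
    rw [List.singleton_sublist, Finset.mem_toList]
    exact hs
  · have hnd := ndist_spec hB
    have hn0 : ndist (rel E A) ℓ s t ≠ 0 := by
      intro h0
      rw [h0] at hnd
      obtain ⟨l, h1, h2⟩ := hnd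
      cases l with
      | nil => exact hst h1
      | cons v l =>
        have := hpos _ _ h1.1.2.2
        simp only [walkLen] at h2
        omega
    have hlt := hJ s t B hB
    obtain ⟨l', h1, h2, h3⟩ := hW2 (Nat.log 2 (ndist (rel E A) ℓ s t))
      (Nat.log_lt_of_lt_pow hn0 hlt) (s, t) (by
        refine Finset.mem_filter.2 ⟨Finset.mem_product.2 ⟨hs, ht⟩, ⟨B, hB⟩,
          Nat.pow_log_le_self 2 hn0, ?_⟩
        rw [← pow_succ']
        exact (Nat.lt_pow_succ_log_self (by norm_num) _).le)
    exact ⟨l', h1, h2.trans (List.sublist_append_right _ _),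
      h3.trans (Nat.mul_le_mul_left _ (ndist_le hB))⟩

lemma universal_word {V : Type*} [Fintype V] (E : V → V → Prop) (ℓ : V → V → ℕ)
    (hpos : ∀ u v, E u v → 0 < ℓ u v)
    (e ρ J Λ M Z : ℕ) (he : 1 ≤ e) (hJ1 : 1 ≤ J) (hM : 1 ≤ M)
    (hρ : Fintype.card V * Fintype.card V < 2 ^ ρ)
    (hJ : ∀ (A : Finset V) s t B, DLe (rel E A) ℓ s t B → ndist (rel E A) ℓ s t < 2 ^ J)
    (hΛ : Nat.log 2 (Fintype.card V) ≤ Λ)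
    (hZ : 1 + J * (ρ * (2 * (32 * (ρ + J) * Λ * e) + 3)) ≤ Z) :
    ∀ j : ℕ, ∀ A : Finset V, A.card ≤ M ^ j →
      ∃ W : List V, W.length ≤ A.card * (M * Z ^ j) ∧ Good E ℓ W A ((e + 1) ^ j) (e ^ j) := by
  intro j
  induction j with
  | zero =>
    intro A hA
    refine ⟨A.toList, ?_, ?_⟩
    · rw [Finset.length_toList]
      exact Nat.le_mul_of_pos_right _ (by simp; omega)
    · intro s hs t ht B hB
      have hst : s = t := Finset.card_le_one.1 (by simpa using hA) s hs t ht
      subst hst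
      refine ⟨[], rfl, ?_, by simp [walkLen]⟩
      rw [List.singleton_sublist, Finset.mem_toList]
      exact hs
  | succ j ih =>
    intro A hA
    obtain ⟨W, h1, h2⟩ := universal_step E ℓ hpos A e ρ J Λ ((e + 1) ^ j) (e ^ j) (M ^ j) M
      (M * Z ^ j) he hJ1 hρ (hJ A) ((Nat.log_mono_right (Finset.card_le_univ A)).trans hΛ)
      (Nat.pow_le_pow_left (by omega) _) (by rw [← pow_succ']; exact hA) ih
    refine ⟨W, h1.trans ?_, ?_⟩
    · set R := 2 * (32 * (ρ + J) * Λ * e) with hR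
      have hZ1 : 1 ≤ Z := by omega
      have hZj : 1 ≤ Z ^ j := Nat.one_le_pow _ _ hZ1
      have hMZ : 1 ≤ M * Z ^ j := Nat.one_le_iff_ne_zero.2 (by positivity)
      calc A.card + J * (ρ * ((R + 1) * (A.card * (M * Z ^ j)) + M * (2 * A.card)))
          ≤ A.card * (M * Z ^ j) + J * (ρ * ((R + 1) * (A.card * (M * Z ^ j)) +
            (M * Z ^ j) * (2 * A.card))) := by
            gcongr
            · exact Nat.le_mul_of_pos_right _ hMZ
            · exact Nat.le_mul_of_pos_right _ hZj
        _ = A.card * (M * (Z ^ j * (1 + J * (ρ * (R + 3))))) := by ring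
        _ ≤ A.card * (M * (Z ^ j * Z)) := by gcongr
        _ = _ := by rw [pow_succ]
    · rw [pow_succ', pow_succ']
      exact h2

/-! ### From words to preservers -/

lemma lift_walk {V : Type*} {E : V → V → Prop} {ℓ : V → V → ℕ} {N : ℕ} (w : Fin N → V) {t : V}
    (is : List (Fin N)) : ∀ i : Fin N, (i :: is).Pairwise (· < ·) →
    IsWalk E (w i) t (is.map w) →
    ∃ j, w j = t ∧ IsWalk (fun i j => i < j ∧ E (w i) (w j)) i j is ∧
      walkLen (fun i j => ℓ (w i) (w j)) i is = walkLen ℓ (w i) (is.map w) := by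
  induction is with
  | nil => intro i _ h; exact ⟨i, h, rfl, rfl⟩
  | cons a is ih =>
    intro i hp h
    rw [List.pairwise_cons] at hp
    obtain ⟨j, h1, h2, h3⟩ := ih a hp.2 h.2
    refine ⟨j, h1, ⟨⟨hp.1 a (by simp), h.1⟩, h2⟩, ?_⟩
    simp only [walkLen, List.map_cons, h3]

lemma proj_walk {V : Type*} {E : V → V → Prop} {ℓ : V → V → ℕ} {N : ℕ} (w : Fin N → V)
    {F : Fin N → Fin N → Prop} (hF : ∀ i j, F i j → E (w i) (w j)) {j : Fin N}
    (is : List (Fin N)) : ∀ i : Fin N, IsWalk F i j is →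
    IsWalk E (w i) (w j) (is.map w) ∧
      walkLen (fun i j => ℓ (w i) (w j)) i is = walkLen ℓ (w i) (is.map w) := by
  induction is with
  | nil => intro i h; exact ⟨congrArg w h, rfl⟩
  | cons a is ih =>
    intro i h
    obtain ⟨h1, h2⟩ := ih a h.2
    refine ⟨⟨hF _ _ h.1, h1⟩, ?_⟩
    simp only [walkLen, List.map_cons, h2]

lemma preserver_of_word {V : Type*} [Fintype V] (E : V → V → Prop) (ℓ : V → V → ℕ) (W : List V)
    (a b : ℕ) (hW : Good E ℓ W Finset.univ a b) (P : Set (V × V)) :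
    ∃ EH : V → V → Prop, (∀ u v, EH u v → E u v) ∧
      (({p : V × V | EH p.1 p.2}.ncard : ℝ) ≤ W.length + P.ncard * Real.sqrt W.length) ∧
      ∀ p ∈ P, ∀ B, DLe E ℓ p.1 p.2 B → ∃ B', DLe EH ℓ p.1 p.2 B' ∧ b * B' ≤ a * B := by
  set w : Fin W.length → V := W.get with hw
  set F : Fin W.length → Fin W.length → Prop := fun i j => i < j ∧ E (w i) (w j) with hF
  set ℓ' : Fin W.length → Fin W.length → ℕ := fun i j => ℓ (w i) (w j) with hℓ'
  have hrel : ∀ u v, rel E Finset.univ u v → E u v := fun u v h => h.2.2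
  have hrel' : ∀ u v, E u v → rel E Finset.univ u v :=
    fun u v h => ⟨Finset.mem_univ _, Finset.mem_univ _, h⟩
  have hpos : ∀ p : V × V, ∃ q : Option (Fin W.length × Fin W.length),
      ∀ B, DLe E ℓ p.1 p.2 B → ∃ i j, q = some (i, j) ∧ w i = p.1 ∧ w j = p.2 ∧
        ∃ B', DLe F ℓ' i j B' ∧ b * B' ≤ a * B := by
    intro p
    by_cases h : ∃ B, DLe E ℓ p.1 p.2 B
    · obtain ⟨B, hB⟩ := h
      obtain ⟨l, h1, h2, h3⟩ := hW p.1 (Finset.mem_univ _) p.2 (Finset.mem_univ _) _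
        ((ndist_spec hB).mono hrel' le_rfl)
      obtain ⟨is, g1, g2⟩ := List.sublist_eq_map_getElem h2
      cases is with
      | nil => simp at g1
      | cons i is =>
        simp only [List.map_cons, List.cons.injEq] at g1
        obtain ⟨g1, g3⟩ := g1
        have e1 : w i = p.1 := by rw [g1]; rfl
        have e3 : l = is.map w := by rw [g3]; rfl
        have h1' := isWalk_mono hrel h1
        rw [e3, ← e1] at h1'
        obtain ⟨j, k1, k2, k3⟩ := lift_walk (ℓ := ℓ) w is i g2 h1'
        refine ⟨some (i, j), fun B hB => ⟨i, j, rfl, e1, k1, _, ⟨is, k2, le_rfl⟩, ?_⟩⟩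
        have : walkLen ℓ' i is = walkLen ℓ p.1 l := by rw [e3, ← e1]; exact k3
        rw [this]
        exact h3.trans (Nat.mul_le_mul_left _ (ndist_le hB))
    · exact ⟨none, fun B hB => absurd ⟨B, hB⟩ h⟩
  choose q hq using hpos
  set Pf : Finset (V × V) := P.toFinite.toFinset with hPf
  set Q : Finset (Fin W.length × Fin W.length) := (Pf.image q).eraseNone with hQ
  have hQcard : Q.card ≤ P.ncard := by
    rw [Set.ncard_eq_toFinset_card P P.toFinite]
    refine le_trans ?_ (Finset.card_image_le (s := Pf) (f := q))
    rw [hQ, ← Finset.card_map Function.Embedding.some, Finset.map_some_eraseNone]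
    exact Finset.card_le_card (Finset.erase_subset _ _)
  obtain ⟨H, hH1, hH2, hH3⟩ := dag_preserver F (fun i j h => h.1) ℓ' Q
  refine ⟨fun u v => ∃ i j, (i, j) ∈ H ∧ w i = u ∧ w j = v, ?_, ?_, ?_⟩
  · rintro u v ⟨i, j, h, rfl, rfl⟩
    exact (hH1 _ h).2
  · have hsub : {p : V × V | ∃ i j, (i, j) ∈ H ∧ w i = p.1 ∧ w j = p.2} ⊆
        ((H.image (fun e => (w e.1, w e.2)) : Finset (V × V)) : Set (V × V)) := by
      rintro ⟨u, v⟩ ⟨i, j, h, h1, h2⟩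
      rw [Finset.mem_coe, Finset.mem_image]
      exact ⟨(i, j), h, Prod.ext h1 h2⟩
    have h1 := Set.ncard_le_ncard hsub (Finset.finite_toSet _)
    rw [Set.ncard_coe_finset] at h1
    have h2 := h1.trans Finset.card_image_le
    have h3 : (({p : V × V | ∃ i j, (i, j) ∈ H ∧ w i = p.1 ∧ w j = p.2}.ncard : ℕ) : ℝ) ≤ H.card := by
      exact_mod_cast h2
    refine h3.trans (hH2.trans ?_)
    gcongr
  · intro p hp B hB
    obtain ⟨i, j, h1, h2, h3, B', h4, h5⟩ := hq p B hB
    have hmem : (i, j) ∈ Q := by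
      rw [hQ, Finset.mem_eraseNone, Finset.mem_image]
      exact ⟨p, by simpa [hPf] using hp, h1⟩
    obtain ⟨is, k1, k2⟩ := hH3 _ hmem B' h4
    obtain ⟨m1, m2⟩ := proj_walk (E := fun u v => ∃ i j, (i, j) ∈ H ∧ w i = u ∧ w j = v) (ℓ := ℓ) w
      (F := fun i j => (i, j) ∈ H) (fun i j h => ⟨i, j, h, rfl, rfl⟩) is i k1
    refine ⟨B', ⟨is.map w, ?_, ?_⟩, h5⟩
    · rw [← h2, ← h3]; exact m1
    · rw [← h2, ← m2]; exact k2

lemma polylog_bound (C : ℝ) (hC : 0 < C) (r : ℕ) (δ : ℝ) (hδ : 0 < δ) :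
    ∃ n₀ : ℕ, ∀ n : ℕ, n₀ ≤ n → C * ((Nat.log 2 n + 1 : ℕ) : ℝ) ^ r ≤ (n : ℝ) ^ δ := by
  have h := (isLittleO_log_rpow_rpow_atTop (r : ℝ) hδ).def (c := 1 / (C * 3 ^ r)) (by positivity)
  have h' := (tendsto_natCast_atTop_atTop (R := ℝ)).eventually h
  obtain ⟨n₁, hn₁⟩ := Filter.eventually_atTop.1 h'
  refine ⟨max n₁ 3, fun n hn => ?_⟩
  have h1 := hn₁ n (le_trans (le_max_left _ _) hn)
  have h3 : 3 ≤ n := le_trans (le_max_right _ _) hn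
  have hn0 : (0 : ℝ) < n := by positivity
  have h3' : (3 : ℝ) ≤ n := by exact_mod_cast h3
  have hlog1 : 1 ≤ Real.log n := by
    rw [Real.le_log_iff_exp_le hn0]
    exact (Real.exp_one_lt_d9.le.trans (by norm_num)).trans h3'
  have hl : ((Nat.log 2 n + 1 : ℕ) : ℝ) ≤ 3 * Real.log n := by
    have h4 : ((2 ^ Nat.log 2 n : ℕ) : ℝ) ≤ n := by
      exact_mod_cast Nat.pow_log_le_self 2 (by omega)
    have h5 : (Nat.log 2 n : ℝ) * Real.log 2 ≤ Real.log n := by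
      rw [← Real.log_pow]
      apply Real.log_le_log (by positivity)
      exact_mod_cast h4
    have := Real.log_two_gt_d9
    have h6 : (0:ℝ) ≤ Nat.log 2 n := by positivity
    push_cast
    nlinarith
  rw [Real.norm_of_nonneg (by positivity), Real.norm_of_nonneg (by positivity),
    Real.rpow_natCast] at h1
  calc C * ((Nat.log 2 n + 1 : ℕ) : ℝ) ^ r ≤ C * (3 * Real.log n) ^ r := by gcongr
    _ = (C * 3 ^ r) * Real.log n ^ r := by rw [mul_pow]; ring
    _ ≤ (C * 3 ^ r) * (1 / (C * 3 ^ r) * (n : ℝ) ^ δ) := by gcongr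
    _ = _ := by field_simp

lemma one_add_inv_pow (L x : ℕ) (hL : 1 ≤ L) (hx : 1 ≤ x) :
    ((((2 * L * x : ℕ) : ℝ) + 1) / ((2 * L * x : ℕ) : ℝ)) ^ L ≤ 1 + 1 / x := by
  have hL' : (1 : ℝ) ≤ L := by exact_mod_cast hL
  have hx' : (1 : ℝ) ≤ x := by exact_mod_cast hx
  set y : ℝ := 1 / (2 * x) with hy
  have hy0 : 0 ≤ y := by positivity
  have hy1 : y ≤ 1 := by
    rw [hy, div_le_one (by positivity)]; linarith
  have e1 : (((2 * L * x : ℕ) : ℝ) + 1) / ((2 * L * x : ℕ) : ℝ) = 1 + y / L := by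
    push_cast
    rw [hy]
    field_simp
  rw [e1]
  calc (1 + y / L) ^ L ≤ (Real.exp (y / L)) ^ L := by
        gcongr
        rw [add_comm]; exact Real.add_one_le_exp _
    _ = Real.exp y := by
        rw [← Real.exp_nat_mul]
        congr 1
        field_simp
    _ ≤ 1 + y + y ^ 2 := by
        have := Real.abs_exp_sub_one_sub_id_le (x := y) (by rw [abs_of_nonneg hy0]; exact hy1)
        have := (abs_le.1 this).2
        linarith
    _ ≤ 1 + 2 * y := by nlinarith
    _ = 1 + 1 / x := by rw [hy]; field_simp

/-- For every `c > 0` and integers `k, b ≥ 1` there is `n₀`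
such that for every directed graph `G` on `n ≥ n₀` vertices with positive
integer edge lengths at most `n^k`, every `ε` with `1/(log₂ n)^b ≤ ε < 1`, and
every set `P` of `p` demand pairs, there exists a subgraph `H` of `G` with at
most `(n + p·√n)·n^c` edges such that `dist_H(s,t) ≤ (1+ε)·dist_G(s,t)` for
every `(s,t) ∈ P`. -/
theorem statement9 :
    ∀ c : ℝ, 0 < c → ∀ k b : ℕ, 1 ≤ k → 1 ≤ b →
    ∃ n₀ : ℕ, ∀ (VG : Type) (_ : Finite VG) (EG : VG → VG → Prop) (ℓG : VG → VG → ℕ),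
      n₀ ≤ Nat.card VG →
      (∀ u v, EG u v → 0 < ℓG u v ∧ ℓG u v ≤ (Nat.card VG) ^ k) →
      ∀ ε : ℝ, 1 / (Real.logb 2 (Nat.card VG)) ^ b ≤ ε → ε < 1 →
      ∀ P : Set (VG × VG),
      ∃ EH : VG → VG → Prop,
        (∀ u v, EH u v → EG u v) ∧
        (({p : VG × VG | EH p.1 p.2}.ncard : ℝ) ≤
          ((Nat.card VG : ℝ) + (P.ncard : ℝ) * Real.sqrt (Nat.card VG)) *
            (Nat.card VG : ℝ) ^ c) ∧
        (∀ p ∈ P, gdist EH ℓG p.1 p.2 ≤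
          (1 + ENNReal.ofReal ε) * gdist EG ℓG p.1 p.2) := by
  intro c hc k b hk hb
  obtain ⟨L₀, hL₀⟩ := exists_nat_gt (2 / c)
  set L : ℕ := L₀ + 1 with hLdef
  have hL1 : 1 ≤ L := by omega
  have hLpos : (0 : ℝ) < L := by positivity
  have hLc : 1 / (L : ℝ) ≤ c / 2 := by
    rw [div_le_iff₀ hLpos]
    have : 2 / c ≤ L := by rw [hLdef]; push_cast; linarith
    rw [div_le_iff₀ hc] at this
    linarith
  set C : ℕ := 270 * L * (k + 3) ^ 2 with hC
  have hC1 : 1 ≤ C := Nat.one_le_iff_ne_zero.2 (by positivity)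
  obtain ⟨n₀, hn₀⟩ := polylog_bound (2 * (C : ℝ) ^ L) (by positivity) ((4 + b) * L) (c / 2)
    (by positivity)
  refine ⟨max n₀ 2, ?_⟩
  intro VG hfin EG ℓG hn hℓ ε hε1 hε2 P
  letI : Fintype VG := Fintype.ofFinite VG
  set n : ℕ := Nat.card VG with hndef
  have hcard : Fintype.card VG = n := by rw [hndef, Nat.card_eq_fintype_card]
  have hn2 : 2 ≤ n := le_trans (le_max_right _ _) hn
  have hnn : n₀ ≤ n := le_trans (le_max_left _ _) hn
  have hnR : (1 : ℝ) ≤ n := by exact_mod_cast (by omega : 1 ≤ n)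
  set lam : ℕ := Nat.log 2 n + 1 with hlam
  have hlam1 : 1 ≤ lam := by omega
  have hnlam : n < 2 ^ lam := Nat.lt_pow_succ_log_self (by norm_num) n
  set e : ℕ := 2 * L * lam ^ b with he
  have hlb1 : 1 ≤ lam ^ b := Nat.one_le_pow _ _ hlam1
  have he1 : 1 ≤ e := Nat.one_le_iff_ne_zero.2 (by positivity)
  set M : ℕ := ⌈(n : ℝ) ^ (1 / (L : ℝ))⌉₊ with hM
  have hroot : (1 : ℝ) ≤ (n : ℝ) ^ (1 / (L : ℝ)) := Real.one_le_rpow hnR (by positivity)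
  have hMge : (n : ℝ) ^ (1 / (L : ℝ)) ≤ M := Nat.le_ceil _
  have hM1 : 1 ≤ M := by exact_mod_cast hroot.trans hMge
  have hMle : (M : ℝ) ≤ 2 * (n : ℝ) ^ (c / 2) := by
    have h1 : (M : ℝ) < (n : ℝ) ^ (1 / (L : ℝ)) + 1 := Nat.ceil_lt_add_one (by positivity)
    have h2 : (n : ℝ) ^ (1 / (L : ℝ)) ≤ (n : ℝ) ^ (c / 2) := Real.rpow_le_rpow_of_exponent_le hnR hLc
    linarith
  have hML : n ≤ M ^ L := by
    have h1 : ((n : ℝ) ^ (1 / (L : ℝ))) ^ L = n := by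
      rw [← Real.rpow_natCast, ← Real.rpow_mul (by positivity)]
      rw [one_div_mul_cancel hLpos.ne', Real.rpow_one]
    have h2 : (n : ℝ) ≤ (M : ℝ) ^ L := by
      rw [← h1]
      gcongr
    exact_mod_cast h2
  set Z : ℕ := C * lam ^ (4 + b) with hZ
  have hpos : ∀ u v, EG u v → 0 < ℓG u v := fun u v h => (hℓ u v h).1
  obtain ⟨W, hW1, hW2⟩ := universal_word EG ℓG hpos e (2 * lam) (lam * (k + 1)) lam M Z he1
    (Nat.one_le_iff_ne_zero.2 (by positivity)) hM1
    (by
      rw [hcard, two_mul, pow_add]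
      exact Nat.mul_lt_mul'' hnlam hnlam)
    (by
      intro A s t B hB
      have h1 := ndist_bound (K := n ^ k) (fun u v h => hℓ u v h.2.2) hB
      rw [hcard, ← pow_succ'] at h1
      refine lt_of_le_of_lt h1 ?_
      rw [pow_mul]
      exact Nat.pow_lt_pow_left hnlam (by omega))
    (by rw [hcard]; omega)
    (by
      rw [hZ, hC]
      have hx : 1 ≤ lam ^ 2 * e := Nat.one_le_iff_ne_zero.2 (by positivity)
      have hx4 : 1 ≤ (k + 3) ^ 2 * (lam ^ 4 * e) := Nat.one_le_iff_ne_zero.2 (by positivity)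
      calc 1 + lam * (k + 1) * (2 * lam * (2 * (32 * (2 * lam + lam * (k + 1)) * lam * e) + 3))
          = 1 + lam * (k + 1) * (2 * lam * (64 * (k + 3) * (lam ^ 2 * e) + 3 * 1)) := by ring
        _ ≤ (k + 3) ^ 2 * (lam ^ 4 * e) +
            lam * (k + 3) * (2 * lam * (64 * (k + 3) * (lam ^ 2 * e) +
              3 * ((k + 1) * (lam ^ 2 * e)))) := by
            gcongr
            · omega
            · exact Nat.mul_pos (by omega) hx
        _ ≤ (k + 3) ^ 2 * (lam ^ 4 * e) +
            lam * (k + 3) * (2 * lam * (64 * (k + 3) * (lam ^ 2 * e) +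
              3 * ((k + 3) * (lam ^ 2 * e)))) := by
            gcongr
            omega
        _ = 135 * (k + 3) ^ 2 * lam ^ 4 * e := by ring
        _ = 270 * L * (k + 3) ^ 2 * lam ^ (4 + b) := by rw [he]; ring)
    L Finset.univ (by rw [Finset.card_univ, hcard]; exact hML)
  rw [Finset.card_univ, hcard] at hW1
  have hnc1 : (1 : ℝ) ≤ (n : ℝ) ^ c := Real.one_le_rpow hnR hc.le
  have hWlen : (W.length : ℝ) ≤ n * (n : ℝ) ^ c := by
    have h1 : (W.length : ℝ) ≤ n * (M * (Z : ℝ) ^ L) := by exact_mod_cast hW1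
    refine h1.trans ?_
    have h2 := hn₀ n hnn
    have h3 : 2 * (Z : ℝ) ^ L ≤ (n : ℝ) ^ (c / 2) := by
      refine le_trans (le_of_eq ?_) h2
      rw [hZ]
      push_cast
      rw [mul_pow, ← pow_mul, mul_assoc]
      norm_num [hlam]
    have h4 : (n : ℝ) ^ c = (n : ℝ) ^ (c / 2) * (n : ℝ) ^ (c / 2) := by
      rw [← Real.rpow_add (by positivity)]
      congr 1
      ring
    rw [h4]
    refine mul_le_mul_of_nonneg_left ?_ (by positivity)
    calc (M : ℝ) * (Z : ℝ) ^ L ≤ (2 * (n : ℝ) ^ (c / 2)) * (Z : ℝ) ^ L := by gcongr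
      _ = (n : ℝ) ^ (c / 2) * (2 * (Z : ℝ) ^ L) := by ring
      _ ≤ _ := by gcongr
  obtain ⟨EH, h1, h2, h3⟩ := preserver_of_word EG ℓG W _ _ hW2 P
  refine ⟨EH, h1, h2.trans ?_, ?_⟩
  · have hs : Real.sqrt W.length ≤ Real.sqrt n * (n : ℝ) ^ c := by
      refine (Real.sqrt_le_sqrt hWlen).trans ?_
      rw [Real.sqrt_mul (by positivity)]
      gcongr
      rw [Real.sqrt_le_left (by positivity)]
      exact le_self_pow₀ hnc1 (by norm_num)
    calc (W.length : ℝ) + P.ncard * Real.sqrt W.length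
        ≤ n * (n : ℝ) ^ c + P.ncard * (Real.sqrt n * (n : ℝ) ^ c) := by gcongr
      _ = _ := by ring
  · intro p hp
    by_cases hr : ∃ B, DLe EG ℓG p.1 p.2 B
    · obtain ⟨B₀, hB₀⟩ := hr
      obtain ⟨B', ⟨l, hl1, hl2⟩, hB'2⟩ := h3 p hp _ (ndist_spec hB₀)
      set B := ndist EG ℓG p.1 p.2 with hB
      have hG : (B : ℝ≥0∞) ≤ gdist EG ℓG p.1 p.2 := by
        unfold gdist
        refine le_iInf₂ fun l hl => ?_
        exact_mod_cast ndist_le ⟨l, hl, le_rfl⟩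
      have hH : gdist EH ℓG p.1 p.2 ≤ (B' : ℝ≥0∞) := by
        unfold gdist
        refine (iInf₂_le l hl1).trans ?_
        exact_mod_cast hl2
      have hlogb : (1 : ℝ) ≤ Real.logb 2 n := by
        rw [Real.le_logb_iff_rpow_le (by norm_num) (by positivity)]
        simpa using (by exact_mod_cast hn2 : (2 : ℝ) ≤ n)
      have hlogle : Real.logb 2 n ≤ lam := by
        rw [Real.logb_le_iff_le_rpow (by norm_num) (by positivity), Real.rpow_natCast]
        exact_mod_cast hnlam.le
      have hεlam : 1 / ((lam ^ b : ℕ) : ℝ) ≤ ε := by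
        refine le_trans ?_ hε1
        push_cast
        gcongr
      have hε0 : 0 ≤ ε := le_trans (by positivity) hεlam
      have hreal : (B' : ℝ) ≤ (1 + ε) * B := by
        have g1 := one_add_inv_pow L (lam ^ b) hL1 hlb1
        rw [← he, div_pow] at g1
        have g2 : (e : ℝ) ^ L * B' ≤ ((e : ℝ) + 1) ^ L * B := by exact_mod_cast hB'2
        have hep : (0 : ℝ) < (e : ℝ) ^ L := by positivity
        calc (B' : ℝ) ≤ ((e : ℝ) + 1) ^ L * B / (e : ℝ) ^ L := by
              rw [le_div_iff₀ hep]; linarith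
          _ = ((e : ℝ) + 1) ^ L / (e : ℝ) ^ L * B := by ring
          _ ≤ (1 + ε) * B := by
              gcongr
              linarith
      refine hH.trans (le_trans ?_ (mul_le_mul_right hG _))
      rw [← ENNReal.ofReal_natCast B', ← ENNReal.ofReal_natCast B, ← ENNReal.ofReal_one,
        ← ENNReal.ofReal_add (by norm_num) hε0, ← ENNReal.ofReal_mul (by positivity)]
      exact ENNReal.ofReal_le_ofReal hreal
    · have : gdist EG ℓG p.1 p.2 = ⊤ := by
        unfold gdist
        simp only [iInf_eq_top]
        intro l hl
        exact absurd ⟨_, l, hl, le_rfl⟩ hr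
      rw [this, ENNReal.mul_top (by simp)]
      exact le_top
end

section
/- Let V be a finite set, let 𝒞' = (C_1,…,C_z) and 𝒟 = (D_1,…,D_{z'}) be ordered partitions of V, and let ℰ be the sequence of all nonempty intersections D_x ∩ C_y, ordered lexicographically first by x and then by y. Then ℰ is an ordered partition of V that refines 𝒟, and for every edge set E ⊆ V × V we have Erev(ℰ) ⊆ Erev(𝒞') ∪ Erev(𝒟). -/
open scoped Classical

/-- An ordered partition of `V`: a list of nonempty pairwise disjoint sets
covering `V`. -/
def IsOrderedPartition {V : Type*} (L : List (Set V)) : Prop :=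
  (∀ A ∈ L, A.Nonempty) ∧ L.Pairwise Disjoint ∧ (⋃ A ∈ L, A) = Set.univ

/-- `L` refines `L'`: `L` is the concatenation of consecutive blocks, the `k`-th
of which covers the `k`-th part of `L'`. -/
def Refines {V : Type*} (L L' : List (Set V)) : Prop :=
  ∃ B : List (List (Set V)), B.flatten = L ∧ B.length = L'.length ∧
    ∀ q ∈ B.zip L', (⋃ A ∈ q.1, A) = q.2

/-- The set of reversed edges of `E` with respect to the ordered partition `L`. -/
def Erev {V : Type*} (E : Set (V × V)) (L : List (Set V)) : Set (V × V) :=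
  {p | p ∈ E ∧ ∃ i j : ℕ, ∃ (hi : i < L.length) (hj : j < L.length),
    p.1 ∈ L[i] ∧ p.2 ∈ L[j] ∧ j < i}

theorem mem_Erev_iff_not_pairwise {V : Type*} (E : Set (V × V)) (L : List (Set V)) (p : V × V) :
    p ∈ Erev E L ↔ p ∈ E ∧ ¬ L.Pairwise (fun A B => ¬ (p.2 ∈ A ∧ p.1 ∈ B)) := by
  rw [List.pairwise_iff_getElem]
  simp only [Erev, Set.mem_setOf_eq]
  push Not
  constructor
  · rintro ⟨h, i, j, hi, hj, h1, h2, h3⟩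
    exact ⟨h, j, i, hj, hi, h3, h2, h1⟩
  · rintro ⟨h, j, i, hj, hi, h3, h2, h1⟩
    exact ⟨h, i, j, hi, hj, h1, h2, h3⟩

theorem pairwise_lex {V : Type*} (R : Set V → Set V → Prop)
    (hR : ∀ A B A' B', A' ⊆ A → B' ⊆ B → R A B → R A' B') (LC LD : List (Set V))
    (hC : LC.Pairwise R) (hD : LD.Pairwise R) :
    ((LD.map (fun Dx => (LC.map (fun Cy => Dx ∩ Cy)).filter
      (fun A => decide A.Nonempty))).flatten).Pairwise R := by
  rw [List.pairwise_flatten]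
  constructor
  · intro l hl
    obtain ⟨D, _, rfl⟩ := List.mem_map.1 hl
    apply List.Pairwise.filter
    rw [List.pairwise_map]
    exact hC.imp (fun h => hR _ _ _ _ Set.inter_subset_right Set.inter_subset_right h)
  · rw [List.pairwise_map]
    refine hD.imp (fun {D D'} h => ?_)
    intro x hx y hy
    obtain ⟨C, _, rfl⟩ := List.mem_map.1 (List.mem_filter.1 hx).1
    obtain ⟨C', _, rfl⟩ := List.mem_map.1 (List.mem_filter.1 hy).1
    exact hR _ _ _ _ Set.inter_subset_left Set.inter_subset_left h

theorem block_union {V : Type*} (LC : List (Set V)) (hC : (⋃ A ∈ LC, A) = Set.univ) (D : Set V) :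
    (⋃ A ∈ (LC.map (fun Cy => D ∩ Cy)).filter (fun A => decide A.Nonempty), A) = D := by
  ext v
  simp only [Set.mem_iUnion, List.mem_filter, List.mem_map, decide_eq_true_eq, exists_prop]
  constructor
  · rintro ⟨_, ⟨⟨C, _, rfl⟩, _⟩, h⟩
    exact h.1
  · intro hv
    have h : v ∈ ⋃ A ∈ LC, A := hC ▸ Set.mem_univ v
    simp only [Set.mem_iUnion, exists_prop] at h
    obtain ⟨C, hCm, hvC⟩ := h
    exact ⟨D ∩ C, ⟨⟨C, hCm, rfl⟩, ⟨v, hv, hvC⟩⟩, hv, hvC⟩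

/-- Given ordered partitions `𝒞' = (C_1,…,C_z)` and
`𝒟 = (D_1,…,D_{z'})` of `V`, the lexicographically ordered sequence `ℰ` of all
nonempty intersections `D_x ∩ C_y` is an ordered partition of `V` refining `𝒟`,
and `Erev(ℰ) ⊆ Erev(𝒞') ∪ Erev(𝒟)` for every edge set `E ⊆ V × V`. -/
theorem statement11 {V : Type*} [Fintype V]
    (LC LD : List (Set V))
    (hC : IsOrderedPartition LC) (hD : IsOrderedPartition LD)
    (LE : List (Set V))
    (hLE : LE = (LD.map (fun Dx => (LC.map (fun Cy => Dx ∩ Cy)).filter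
      (fun A => decide A.Nonempty))).flatten) :
    IsOrderedPartition LE ∧ Refines LE LD ∧
    ∀ E : Set (V × V), Erev E LE ⊆ Erev E LC ∪ Erev E LD := by
  subst hLE
  refine ⟨⟨?_, ?_, ?_⟩, ⟨_, rfl, by simp, ?_⟩, ?_⟩
  · intro A hA
    obtain ⟨l, hl, hAl⟩ := List.mem_flatten.1 hA
    obtain ⟨D, _, rfl⟩ := List.mem_map.1 hl
    exact of_decide_eq_true (List.mem_filter.1 hAl).2
  · exact pairwise_lex _ (fun A B A' B' h1 h2 h => Disjoint.mono h1 h2 h) LC LD hC.2.1 hD.2.1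
  · rw [Set.eq_univ_iff_forall]
    intro v
    have h : v ∈ ⋃ A ∈ LD, A := hD.2.2 ▸ Set.mem_univ v
    simp only [Set.mem_iUnion, exists_prop] at h
    obtain ⟨D, hDm, hv⟩ := h
    rw [← block_union LC hC.2.2 D] at hv
    simp only [Set.mem_iUnion, exists_prop] at hv ⊢
    obtain ⟨A, hA, hvA⟩ := hv
    exact ⟨A, List.mem_flatten.2 ⟨_, List.mem_map.2 ⟨D, hDm, rfl⟩, hA⟩, hvA⟩
  · intro q hq
    obtain ⟨i, hi, rfl⟩ := List.getElem_of_mem hq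
    simp only [List.getElem_zip, List.getElem_map]
    exact block_union LC hC.2.2 _
  · intro E p hp
    rw [Set.mem_union, mem_Erev_iff_not_pairwise, mem_Erev_iff_not_pairwise]
    rw [mem_Erev_iff_not_pairwise] at hp
    by_contra hcon
    have h1 := not_or.1 hcon
    refine hp.2 (pairwise_lex _ ?_ LC LD ?_ ?_)
    · exact fun A B A' B' h1 h2 h h' => h ⟨h1 h'.1, h2 h'.2⟩
    · exact by_contra fun h => h1.1 ⟨hp.1, h⟩
    · exact by_contra fun h => h1.2 ⟨hp.1, h⟩
end

section
/- Let G = (V,E) be a directed graph with edge capacities, let D be a DAG partial projection onto G with map π such that π⁻¹(v) ≠ ∅ for every v ∈ V, and let (Δ,∇) be a demand on V. Form D' from D by adding, for each v ∈ V, vertices s_v and t_v together with 'infinite' edges (s_v, v') and (v', t_v) for every v' ∈ π⁻¹(v), a super source s with an edge (s, s_v) of capacity Δ(v), and a super sink t with an edge (t_v, t) of capacity ∇(v). Let S' ⊆ V(D') satisfy s ∈ S', t ∉ S', and suppose S' cuts no infinite edge, i.e., for every v ∈ V and v' ∈ π⁻¹(v): if s_v ∈ S' then v' ∈ S', and if v'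 ∈ S' then t_v ∈ S'. Let S^D := S' ∩ V(D). Then the total capacity of the edges of D' leaving S' is at least val_D(S^D) + Σ_{v ∈ V : π⁻¹(v) ⊄ S^D} Δ(v) + Σ_{v ∈ V : π⁻¹(v) ∩ S^D ≠ ∅} ∇(v). -/
open scoped Classical ENNReal

/-- The vertex set of `D'`: copies of vertices of `D` (`.inl x`), the vertices
`s_v` (`.inr (.inl v)`), the vertices `t_v` (`.inr (.inr (.inl v))`), the super
source `s` (`.inr (.inr (.inr (.inl ())))`) and the super sink `t`
(`.inr (.inr (.inr (.inr ())))`). -/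
abbrev VAux (VD VG : Type*) := VD ⊕ VG ⊕ VG ⊕ Unit ⊕ Unit

/-- The edge relation of the graph `D'` built from `D` by adding, for each
`v ∈ V(G)`, vertices `s_v, t_v` with edges `(s_v, v')` and `(v', t_v)` for every
copy `v'` of `v`, a super source `s` with edges `(s, s_v)`, and a super sink `t`
with edges `(t_v, t)`. -/
def auxEdge {VD VG : Type*} (ED : VD → VD → Prop) (π : VD → Option VG) :
    VAux VD VG → VAux VD VG → Prop
  | Sum.inl x, Sum.inl y => ED x y
  | Sum.inr (Sum.inl v), Sum.inl x => π x = some v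
  | Sum.inl x, Sum.inr (Sum.inr (Sum.inl v)) => π x = some v
  | Sum.inr (Sum.inr (Sum.inr (Sum.inl _))), Sum.inr (Sum.inl _) => True
  | Sum.inr (Sum.inr (Sum.inl _)), Sum.inr (Sum.inr (Sum.inr (Sum.inr _))) => True
  | _, _ => False

/-- The capacities of `D'`: edges of `D` keep their capacities, the edges
`(s_v, v')` and `(v', t_v)` are infinite, `(s, s_v)` has capacity `Δ(v)` and
`(t_v, t)` has capacity `∇(v)`. -/
noncomputable def auxCap {VD VG : Type*} (UD : VD → VD → ℝ) (Dd Nd : VG → ℝ) :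
    VAux VD VG → VAux VD VG → ℝ≥0∞
  | Sum.inl x, Sum.inl y => ENNReal.ofReal (UD x y)
  | Sum.inr (Sum.inl _), Sum.inl _ => ⊤
  | Sum.inl _, Sum.inr (Sum.inr (Sum.inl _)) => ⊤
  | Sum.inr (Sum.inr (Sum.inr (Sum.inl _))), Sum.inr (Sum.inl v) => ENNReal.ofReal (Dd v)
  | Sum.inr (Sum.inr (Sum.inl v)), Sum.inr (Sum.inr (Sum.inr (Sum.inr _))) =>
      ENNReal.ofReal (Nd v)
  | _, _ => 0

/-- The value of the cut `S`: total capacity of the edges leaving `S`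
(extended-real-valued capacities). -/
noncomputable def cutValE {V : Type*} (E : V → V → Prop) (U : V → V → ℝ≥0∞)
    (S : Set V) : ℝ≥0∞ :=
  ∑ᶠ p : V × V, if E p.1 p.2 ∧ p.1 ∈ S ∧ p.2 ∉ S then U p.1 p.2 else 0

/-- The value of the cut `S`: total capacity of the edges leaving `S`
(real-valued capacities). -/
noncomputable def cutValR {V : Type*} (E : V → V → Prop) (U : V → V → ℝ)
    (S : Set V) : ℝ :=
  ∑ᶠ p : V × V, if E p.1 p.2 ∧ p.1 ∈ S ∧ p.2 ∉ S then U p.1 p.2 else 0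

/-- Let `D` be a DAG partial projection onto `G` with
nonempty fibers, `(Δ,∇)` a demand, and `D'` the graph with super source/sink as
above. If `S'` is a cut of `D'` with `s ∈ S'`, `t ∉ S'` cutting no infinite
edge, then, with `S^D := S' ∩ V(D)`, the total capacity of the edges of `D'`
leaving `S'` is at least
`val_D(S^D) + Σ_{v : π⁻¹(v) ⊄ S^D} Δ(v) + Σ_{v : π⁻¹(v) ∩ S^D ≠ ∅} ∇(v)`. -/
theorem statement12 {VG VD : Type*} [Fintype VG] [Fintype VD]
    (EG : VG → VG → Prop) (UG : VG → VG → ℝ) (hUG : ∀ u v, EG u v → 0 ≤ UG u v)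
    (ED : VD → VD → Prop) (UD : VD → VD → ℝ) (hUD : ∀ x y, ED x y → 0 ≤ UD x y)
    (π : VD → Option VG) (hdag : IsDag ED)
    (hfib : ∀ v : VG, {x : VD | π x = some v}.Nonempty)
    (Dd Nd : VG → ℝ) (hDd : ∀ v, 0 ≤ Dd v) (hNd : ∀ v, 0 ≤ Nd v)
    (S' : Set (VAux VD VG))
    (hs : (Sum.inr (Sum.inr (Sum.inr (Sum.inl ()))) : VAux VD VG) ∈ S')
    (ht : (Sum.inr (Sum.inr (Sum.inr (Sum.inr ()))) : VAux VD VG) ∉ S')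
    (hinf : ∀ (v : VG) (x : VD), π x = some v →
      ((Sum.inr (Sum.inl v) : VAux VD VG) ∈ S' → (Sum.inl x : VAux VD VG) ∈ S') ∧
      ((Sum.inl x : VAux VD VG) ∈ S' →
        (Sum.inr (Sum.inr (Sum.inl v)) : VAux VD VG) ∈ S')) :
    ENNReal.ofReal (cutValR ED UD (Sum.inl ⁻¹' S'))
      + ENNReal.ofReal (∑ᶠ v ∈ {v : VG | ¬ {x : VD | π x = some v} ⊆ Sum.inl ⁻¹' S'}, Dd v)
      + ENNReal.ofReal
          (∑ᶠ v ∈ {v : VG | ({x : VD | π x = some v} ∩ Sum.inl ⁻¹' S').Nonempty}, Nd v)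
      ≤ cutValE (auxEdge ED π) (auxCap UD Dd Nd) S' := by
  have h1 : ENNReal.ofReal (cutValR ED UD (Sum.inl ⁻¹' S')) =
      ∑ x : VD, ∑ y : VD, if ED x y ∧ (Sum.inl x : VAux VD VG) ∈ S' ∧
        (Sum.inl y : VAux VD VG) ∉ S' then ENNReal.ofReal (UD x y) else 0 := by
    unfold cutValR
    rw [finsum_eq_sum_of_fintype, ENNReal.ofReal_sum_of_nonneg, Fintype.sum_prod_type]
    · refine Finset.sum_congr rfl fun x _ => Finset.sum_congr rfl fun y _ => ?_
      simp only [Set.mem_preimage]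
      split_ifs <;> simp
    · intro p _
      split_ifs with h
      · exact hUD _ _ h.1
      · exact le_rfl
  have h2 : ENNReal.ofReal
      (∑ᶠ v ∈ {v : VG | ¬ {x : VD | π x = some v} ⊆ Sum.inl ⁻¹' S'}, Dd v) ≤
      ∑ v : VG, if (Sum.inr (Sum.inl v) : VAux VD VG) ∉ S'
        then ENNReal.ofReal (Dd v) else 0 := by
    rw [finsum_mem_eq_finite_toFinset_sum _ (Set.toFinite _),
      ENNReal.ofReal_sum_of_nonneg (fun v _ => hDd v), ← Finset.sum_filter]
    refine Finset.sum_le_sum_of_subset ?_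
    intro v hv
    simp only [Set.Finite.mem_toFinset, Set.mem_ofPred_eq] at hv
    simp only [Finset.mem_filter, Finset.mem_univ, true_and]
    exact fun h => hv fun x hx => (hinf v x hx).1 h
  have h3 : ENNReal.ofReal
      (∑ᶠ v ∈ {v : VG | ({x : VD | π x = some v} ∩ Sum.inl ⁻¹' S').Nonempty}, Nd v) ≤
      ∑ v : VG, if (Sum.inr (Sum.inr (Sum.inl v)) : VAux VD VG) ∈ S'
        then ENNReal.ofReal (Nd v) else 0 := by
    rw [finsum_mem_eq_finite_toFinset_sum _ (Set.toFinite _),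
      ENNReal.ofReal_sum_of_nonneg (fun v _ => hNd v), ← Finset.sum_filter]
    refine Finset.sum_le_sum_of_subset ?_
    intro v hv
    simp only [Set.Finite.mem_toFinset, Set.mem_ofPred_eq] at hv
    simp only [Finset.mem_filter, Finset.mem_univ, true_and]
    obtain ⟨x, hx, hxS⟩ := hv
    exact (hinf v x hx).2 hxS
  rw [h1]
  refine (add_le_add (add_le_add le_rfl h2) h3).trans ?_
  unfold cutValE
  rw [finsum_eq_sum_of_fintype, Fintype.sum_prod_type]
  simp only [Fintype.sum_sum_type, Finset.sum_add_distrib, auxEdge, auxCap, hs, ht,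
    Finset.univ_unique, Finset.sum_singleton, true_and, not_false_eq_true, and_true,
    PUnit.default_eq_unit, false_and, if_false, Finset.sum_const_zero, add_zero, zero_add]
  have key : ∀ a b c d e : ℝ≥0∞, a + b + c ≤ a + d + (b + (e + c)) := fun a b c d e => by
    calc a + b + c ≤ (a + b + c) + (d + e) := le_self_add
      _ = _ := by ring
  convert key _ _ _ _ _
  · rfl
  · rename_i x _ y _
    by_cases h : ED x y ∧ (Sum.inl x : VAux VD VG) ∈ S' ∧ (Sum.inl y : VAux VD VG) ∉ S'
    · exact (if_pos h).trans (if_pos h).symm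
    · exact (if_neg h).trans (if_neg h).symm
end

section
/- Let G = (V,E) be a directed graph with edge capacities U_G, and for v ∈ V let vol(v) denote the sum of U_G(e) over all edges e incident to v (incoming or outgoing). Let D be the directed acyclic graph with vertex set V₁ ∪ {w} ∪ V₂, where V₁ and V₂ are disjoint copies of V with projection π mapping each copy back to its original vertex and π(w) = ⊥, and with edges (v₁, w) of capacity vol(v) for the copy v₁ ∈ V₁ of each v ∈ V, and edges (w, v₂) of capacity vol(v) for the copy v₂ ∈ V₂ of each v ∈ V. Then for every S^D ⊆ V(D), defining S := π(S^D ∩ V₁) if w ∉ S^D and S := π(S^D ∩ V₂) if w ∈ S^D, we have: val_G(S) ≤ val_D(S^D), and {v ∈ V : π⁻¹(v) ⊆ S^D} ⊆ S ⊆ {π(x) : x ∈ S^D, x ≠ w}. -/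
open scoped Classical ENNReal

/-- Vertex set of the base-case DAG `D`: `V₁ ∪ {w} ∪ V₂`, with `.inl v` the copy
of `v` in `V₁`, `.inr (.inl ())` the dummy center `w`, and `.inr (.inr v)` the
copy of `v` in `V₂`. -/
abbrev VBase (V : Type*) := V ⊕ Unit ⊕ V

/-- Edges of the base-case DAG: `(v₁, w)` for every `v₁ ∈ V₁` and `(w, v₂)` for
every `v₂ ∈ V₂`. -/
def baseEdge {V : Type*} : VBase V → VBase V → Prop
  | Sum.inl _, Sum.inr (Sum.inl _) => True
  | Sum.inr (Sum.inl _), Sum.inr (Sum.inr _) => True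
  | _, _ => False

/-- Capacities of the base-case DAG: the edges `(v₁, w)` and `(w, v₂)` have
capacity `vol(v)`. -/
def baseCap {V : Type*} (vol : V → ℝ) : VBase V → VBase V → ℝ
  | Sum.inl v, Sum.inr (Sum.inl _) => vol v
  | Sum.inr (Sum.inl _), Sum.inr (Sum.inr v) => vol v
  | _, _ => 0

/-- The (partial) projection map of the base-case DAG. -/
def baseProj {V : Type*} : VBase V → Option V
  | Sum.inl v => some v
  | Sum.inr (Sum.inl _) => none
  | Sum.inr (Sum.inr v) => some v

/-- For the base-case DAG partial projection `D` (two copies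
of `V` joined through a dummy center `w`, with capacities `vol(v)`), every cut
`S^D` of `D` projects to the cut `S` of `G` (taking the `V₁`-side if `w ∉ S^D`
and the `V₂`-side otherwise) with `val_G(S) ≤ val_D(S^D)` and
`{v : π⁻¹(v) ⊆ S^D} ⊆ S ⊆ π(S^D ∖ {w})`. -/
theorem statement13 {V : Type*} [Fintype V]
    (EG : V → V → Prop) (UG : V → V → ℝ) (hUG : ∀ u v, EG u v → 0 ≤ UG u v)
    (vol : V → ℝ)
    (hvol : ∀ v, vol v =
      ∑ᶠ u, ((if EG v u then UG v u else 0) + (if EG u v then UG u v else 0))) :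
    ∀ SD : Set (VBase V), ∀ S : Set V,
      ((Sum.inr (Sum.inl ()) : VBase V) ∉ SD → S = {v : V | (Sum.inl v : VBase V) ∈ SD}) →
      ((Sum.inr (Sum.inl ()) : VBase V) ∈ SD →
        S = {v : V | (Sum.inr (Sum.inr v) : VBase V) ∈ SD}) →
      cutValR EG UG S ≤ cutValR baseEdge (baseCap vol) SD ∧
      {v : V | {x : VBase V | baseProj x = some v} ⊆ SD} ⊆ S ∧
      S ⊆ {v : V | ∃ x ∈ SD, baseProj x = some v} := by
  intro SD S h1 h2
  have hvol' : ∀ v, vol v =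
      ∑ u, ((if EG v u then UG v u else 0) + (if EG u v then UG u v else 0)) := by
    intro v
    rw [hvol v, finsum_eq_sum_of_fintype]
  have hnn : ∀ u v, 0 ≤ (if EG u v then UG u v else 0) := by
    intro u v
    split_ifs with h
    · exact hUG u v h
    · exact le_rfl
  refine ⟨?_, ?_, ?_⟩
  · unfold cutValR
    rw [finsum_eq_sum_of_fintype, finsum_eq_sum_of_fintype]
    by_cases hw : (Sum.inr (Sum.inl ()) : VBase V) ∈ SD
    · have hS := h2 hw
      have hD : (∑ p : VBase V × VBase V, if baseEdge p.1 p.2 ∧ p.1 ∈ SD ∧ p.2 ∉ SD then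
          baseCap vol p.1 p.2 else 0) = ∑ v : V, if v ∉ S then vol v else 0 := by
        simp [Fintype.sum_prod_type, Fintype.sum_sum_type, baseEdge, baseCap, hw, hS]
      rw [hD, Fintype.sum_prod_type_right]
      apply Finset.sum_le_sum
      intro v _
      by_cases hv : v ∈ S
      · simp [hv]
      · simp only [hv, not_false_eq_true, if_true, and_true]
        rw [hvol' v]
        apply Finset.sum_le_sum
        intro u _
        have a := hnn v u
        have b := hnn u v
        by_cases hu : u ∈ S
        · simp only [hu, and_true]
          linarith
        · simp only [hu, and_false, if_false]
          linarith
    · have hS := h1 hw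
      have hD : (∑ p : VBase V × VBase V, if baseEdge p.1 p.2 ∧ p.1 ∈ SD ∧ p.2 ∉ SD then
          baseCap vol p.1 p.2 else 0) = ∑ v : V, if v ∈ S then vol v else 0 := by
        simp [Fintype.sum_prod_type, Fintype.sum_sum_type, baseEdge, baseCap, hw, hS]
      rw [hD, Fintype.sum_prod_type]
      apply Finset.sum_le_sum
      intro v _
      by_cases hv : v ∈ S
      · simp only [hv, if_true, true_and]
        rw [hvol' v]
        apply Finset.sum_le_sum
        intro u _
        have a := hnn v u
        have b := hnn u v
        by_cases hu : u ∈ S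
        · simp only [hu, not_true_eq_false, and_false, if_false]
          linarith
        · simp only [hu, not_false_eq_true, and_true]
          linarith
      · simp [hv]
  · intro v hv
    by_cases hw : (Sum.inr (Sum.inl ()) : VBase V) ∈ SD
    · rw [h2 hw]
      exact hv (show baseProj (Sum.inr (Sum.inr v)) = some v from rfl)
    · rw [h1 hw]
      exact hv (show baseProj (Sum.inl v) = some v from rfl)
  · intro v hv
    by_cases hw : (Sum.inr (Sum.inl ()) : VBase V) ∈ SD
    · rw [h2 hw] at hv
      exact ⟨_, hv, rfl⟩
    · rw [h1 hw] at hv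
      exact ⟨_, hv, rfl⟩
end

section
/- Let V be a finite set, let (P,Q) be a partition of V, and let d'', vol : V → ℝ≥0 be functions with d''(v) ≤ vol(v) for all v and d''(P) = d''(Q) (where d''(A) = Σ_{v∈A} d''(v)). Let α ≥ 1 and 0 < β ≤ 1, and suppose reals c ≥ 0 (a cut value), v_f ≥ 0 (a flow value), δ ≥ 0, and a set S ⊆ V satisfy: c + d''(S ∩ Q) + d''((V∖S) ∩ P) ≤ α·v_f + δ, v_f ≤ d''(P)·β/(9α), and δ ≤ d''(P)·β/9. Then vol(S) ≥ d''(P)/2, vol(V∖S) ≥ d''(P)/2, c ≤ β·vol(S), and c ≤ β·vol(V∖S). -/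
open scoped Classical

theorem finsum_cover_aux {V : Type*} [Fintype V] (A B C : Set V) (d vol : V → ℝ)
    (hd0 : ∀ v, 0 ≤ d v) (hvol0 : ∀ v, 0 ≤ vol v) (hdvol : ∀ v, d v ≤ vol v)
    (h : ∀ v ∈ A, v ∈ B ∨ v ∈ C) :
    ∑ᶠ v ∈ A, d v ≤ (∑ᶠ v ∈ B, vol v) + ∑ᶠ v ∈ C, d v := by
  rw [finsum_mem_def, finsum_mem_def, finsum_mem_def]
  simp only [finsum_eq_sum_of_fintype]
  rw [← Finset.sum_add_distrib]
  apply Finset.sum_le_sum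
  intro v _
  have a := hd0 v
  have b := hvol0 v
  have e := hdvol v
  have hv := h v
  simp only [Set.indicator_apply]
  split_ifs <;> first | linarith | (exfalso; tauto)

/-- Abstract sparse-cut guarantee: if
`c + d''(S∩Q) + d''(S̄∩P) ≤ α·v_f + δ`, `v_f ≤ d''(P)·β/(9α)` and
`δ ≤ d''(P)·β/9`, then `vol(S), vol(S̄) ≥ d''(P)/2` and
`c ≤ β·vol(S)`, `c ≤ β·vol(S̄)`. -/
theorem statement14 {V : Type*} [Fintype V]
    (P Q : Set V) (hunion : P ∪ Q = Set.univ) (hdisj : Disjoint P Q)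
    (d vol : V → ℝ) (hd0 : ∀ v, 0 ≤ d v) (hvol0 : ∀ v, 0 ≤ vol v)
    (hdvol : ∀ v, d v ≤ vol v)
    (hbal : ∑ᶠ v ∈ P, d v = ∑ᶠ v ∈ Q, d v)
    (α β c vf δ : ℝ) (hα : 1 ≤ α) (hβ0 : 0 < β) (hβ1 : β ≤ 1)
    (hc : 0 ≤ c) (hvf : 0 ≤ vf) (hδ : 0 ≤ δ)
    (S : Set V)
    (h1 : c + (∑ᶠ v ∈ S ∩ Q, d v) + (∑ᶠ v ∈ Sᶜ ∩ P, d v) ≤ α * vf + δ)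
    (h2 : vf ≤ (∑ᶠ v ∈ P, d v) * β / (9 * α))
    (h3 : δ ≤ (∑ᶠ v ∈ P, d v) * β / 9) :
    (∑ᶠ v ∈ P, d v) / 2 ≤ (∑ᶠ v ∈ S, vol v) ∧
    (∑ᶠ v ∈ P, d v) / 2 ≤ (∑ᶠ v ∈ Sᶜ, vol v) ∧
    c ≤ β * (∑ᶠ v ∈ S, vol v) ∧
    c ≤ β * (∑ᶠ v ∈ Sᶜ, vol v) := by
  have hn : ∀ A : Set V, 0 ≤ ∑ᶠ v ∈ A, d v := fun A =>
    finsum_nonneg fun v => finsum_nonneg fun _ => hd0 v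
  have k1 := finsum_cover_aux P S (Sᶜ ∩ P) d vol hd0 hvol0 hdvol (by
    intro v hv
    by_cases hs : v ∈ S
    · exact Or.inl hs
    · exact Or.inr ⟨hs, hv⟩)
  have k2 := finsum_cover_aux Q Sᶜ (S ∩ Q) d vol hd0 hvol0 hdvol (by
    intro v hv
    by_cases hs : v ∈ S
    · exact Or.inr ⟨hs, hv⟩
    · exact Or.inl hs)
  have n0 := hn P
  have n1 := hn (S ∩ Q)
  have n2 := hn (Sᶜ ∩ P)
  rw [← hbal] at k2
  generalize (∑ᶠ v ∈ P, d v) = D at *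
  generalize (∑ᶠ v ∈ S ∩ Q, d v) = x at *
  generalize (∑ᶠ v ∈ Sᶜ ∩ P, d v) = y at *
  have h4 : α * vf ≤ D * β / 9 := by
    rw [le_div_iff₀ (by positivity)] at h2
    linarith
  have h5 : D * β ≤ D := mul_le_of_le_one_right n0 hβ1
  have g1 : D / 2 ≤ ∑ᶠ v ∈ S, vol v := by linarith
  have g2 : D / 2 ≤ ∑ᶠ v ∈ Sᶜ, vol v := by linarith
  have h6 : 0 ≤ D * β := by positivity
  have m1 := mul_le_mul_of_nonneg_left g1 hβ0.le
  have m2 := mul_le_mul_of_nonneg_left g2 hβ0.le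
  exact ⟨g1, g2, by linarith, by linarith⟩
end

section
/- Let G = (V,E) be a directed graph with edge capacities, let (Δ,∇) be a demand on V, and let f be a feasible flow that routes a sub-demand of (Δ,∇). Then for every set S ⊆ V, the value of f satisfies val(f) ≤ val_G(S) + ∇(S) + Δ(V∖S). -/
open scoped Classical

/-- Net outflow of the flow `f` at vertex `v` (sums range over edges only). -/
noncomputable def netOutflow {V : Type*} (E : V → V → Prop) (f : V → V → ℝ) (v : V) : ℝ :=
  (∑ᶠ u, if E v u then f v u else 0) - (∑ᶠ u, if E u v then f u v else 0)

/-- A flow is feasible if it is nonnegative and respects the capacities on every edge. -/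
def FeasibleFlow {V : Type*} (E : V → V → Prop) (U f : V → V → ℝ) : Prop :=
  ∀ u v, E u v → 0 ≤ f u v ∧ f u v ≤ U u v

/-- Value of a flow: sum over the vertices of the positive part of the net outflow. -/
noncomputable def flowValue {V : Type*} (E : V → V → Prop) (f : V → V → ℝ) : ℝ :=
  ∑ᶠ v, max (netOutflow E f v) 0

/-- Weak duality: if the feasible flow `f` routes a
sub-demand of `(Δ,∇)`, then for every `S ⊆ V`,
`val(f) ≤ val_G(S) + ∇(S) + Δ(V∖S)`. -/
theorem statement16 {V : Type*} [Fintype V]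
    (EG : V → V → Prop) (UG : V → V → ℝ)
    (f : V → V → ℝ) (hfeas : FeasibleFlow EG UG f)
    (Dd Nd : V → ℝ) (hDd : ∀ v, 0 ≤ Dd v) (hNd : ∀ v, 0 ≤ Nd v)
    (hroute : ∀ v, -Nd v ≤ netOutflow EG f v ∧ netOutflow EG f v ≤ Dd v) :
    ∀ S : Set V,
      flowValue EG f ≤ cutValR EG UG S + (∑ᶠ v ∈ S, Nd v) + (∑ᶠ v ∈ Sᶜ, Dd v) := by
  intro S
  have key : ∑ v, (if v ∈ S then netOutflow EG f v else 0) ≤ cutValR EG UG S := by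
    unfold cutValR
    rw [finsum_eq_sum_of_fintype, Fintype.sum_prod_type]
    have h1 : ∑ v, (if v ∈ S then netOutflow EG f v else 0)
        = ∑ v, ∑ u, ((if v ∈ S then (if EG v u then f v u else 0) else 0)
          - (if u ∈ S then (if EG v u then f v u else 0) else 0)) := by
      simp only [Finset.sum_sub_distrib]
      rw [Finset.sum_comm (f := fun v u => if u ∈ S then (if EG v u then f v u else 0) else 0),
        ← Finset.sum_sub_distrib]
      refine Finset.sum_congr rfl fun v _ => ?_
      by_cases hv : v ∈ S
      · simp only [hv, if_true, netOutflow, finsum_eq_sum_of_fintype]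
      · simp [hv]
    rw [h1]
    refine Finset.sum_le_sum fun v _ => Finset.sum_le_sum fun u _ => ?_
    by_cases hE : EG v u
    · have := hfeas v u hE
      by_cases hv : v ∈ S <;> by_cases hu : u ∈ S <;> simp [hE, hv, hu] <;> linarith
    · simp [hE]
  rw [finsum_mem_def, finsum_mem_def, finsum_eq_sum_of_fintype, finsum_eq_sum_of_fintype]
  unfold flowValue
  rw [finsum_eq_sum_of_fintype]
  calc ∑ v, max (netOutflow EG f v) 0
      ≤ ∑ v, ((if v ∈ S then netOutflow EG f v else 0) + S.indicator Nd v
          + Sᶜ.indicator Dd v) := by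
        refine Finset.sum_le_sum fun v _ => ?_
        have h := hroute v
        have hd := hDd v
        have hn := hNd v
        by_cases hv : v ∈ S
        · simp [hv]; constructor <;> linarith
        · simp [hv]; constructor <;> linarith
    _ ≤ _ := by
        simp only [Finset.sum_add_distrib]
        linarith
end
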